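/- arXiv:2009.12959 — 9 statements merged into one kernel-verified Lean document; each statement's English description precedes it below -/
import Mathlib

section
/- Let γ ≥ 0 and let c > (α+1)(m σ₀ / α^α)^{1/(α+1)}. Then for every b ∈ (0,1], every function φ : [0,b) → [0,∞) that is continuous at 0 with φ(0) > 0, is positive on (0,b), and solves the trajectory equation on (0,b), satisfies φ(U) ≥ α c U/(α+1) for all U ∈ [0,b). -/
open Set Filter Topology

/-- Right-hand side of the trajectory equation
`φ'(U) = c + γ m U^{m-1} φ^{1-α} - f(U)/φ^α`, where `f(U) = m U^{m-1} h(U)`. -/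
noncomputable def trajRHS (m α γ c : ℝ) (h : ℝ → ℝ) (U φU : ℝ) : ℝ :=
  c + γ * m * U ^ (m - 1) * φU ^ (1 - α) - (m * U ^ (m - 1) * h U) / φU ^ α

/-- Lower linear barrier: if `c > (α+1)(m σ₀/α^α)^{1/(α+1)}`, where
`σ₀ = sup_{U ∈ (0,1]} h(U)/U`, then every positive solution of the trajectory
equation on `(0,b)`, continuous at `0` with `φ(0) > 0`, satisfies
`φ(U) ≥ α c U/(α+1)` on `[0,b)`. -/
theorem statement8 (m p a α σ₀ γ c : ℝ) (h : ℝ → ℝ)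
    (hm : 0 < m) (hp : 1 < p) (hmp : 1 < m * (p - 1)) (hα : α = 1 / (p - 1))
    (ha0 : 0 ≤ a) (ha1 : a < 1)
    (hhC1 : ContDiffOn ℝ 1 h (Ici 0))
    (hh0 : h 0 = 0)
    (hhneg : ∀ u ∈ Icc (0 : ℝ) a, h u ≤ 0)
    (hhpos : ∀ u ∈ Ioo a (1 : ℝ), 0 < h u)
    (hhgt : ∀ u : ℝ, 1 < u → h u < 0)
    (hh1 : deriv h 1 < 0)
    (hσ : IsLUB ((fun U => h U / U) '' Ioc (0 : ℝ) 1) σ₀)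
    (hγ : 0 ≤ γ)
    (hc : (α + 1) * (m * σ₀ / α ^ α) ^ (1 / (α + 1)) < c)
    (b : ℝ) (hb : b ∈ Ioc (0 : ℝ) 1) (φ : ℝ → ℝ)
    (hφcont : ContinuousWithinAt φ (Ico 0 b) 0)
    (hφ0 : 0 < φ 0)
    (hφpos : ∀ U ∈ Ioo (0 : ℝ) b, 0 < φ U)
    (hφode : ∀ U ∈ Ioo (0 : ℝ) b, HasDerivAt φ (trajRHS m α γ c h U (φ U)) U) :
    ∀ U ∈ Ico (0 : ℝ) b, α * c * U / (α + 1) ≤ φ U := by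
  have hp1 : 0 < p - 1 := by linarith
  have hα0 : 0 < α := by rw [hα]; positivity
  have hα1 : 0 < α + 1 := by linarith
  have hαm : α < m := by
    rw [hα, div_lt_iff₀ hp1]; exact hmp
  have hσle : ∀ U ∈ Ioc (0 : ℝ) 1, h U ≤ σ₀ * U := by
    intro U hU
    have h1 : h U / U ≤ σ₀ := hσ.1 ⟨U, hU, rfl⟩
    rwa [div_le_iff₀ hU.1] at h1
  have hσ0 : 0 < σ₀ := by
    have h1 := hhpos ((a + 1) / 2) ⟨by linarith, by linarith⟩
    have h2 := hσle ((a + 1) / 2) ⟨by linarith, by linarith⟩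
    by_contra hcon
    nlinarith
  have hαα : 0 < α ^ α := Real.rpow_pos_of_pos hα0 α
  have hX : 0 < m * σ₀ / α ^ α := by positivity
  have hXr : 0 < (m * σ₀ / α ^ α) ^ (1 / (α + 1)) := Real.rpow_pos_of_pos hX _
  have hc0 : 0 < c := lt_trans (by positivity) hc
  obtain ⟨q, hq⟩ : ∃ q, q = c / (α + 1) := ⟨_, rfl⟩
  have hq0 : 0 < q := by rw [hq]; positivity
  have hcq : c = q * (α + 1) := by rw [hq]; field_simp
  have hqX : (m * σ₀ / α ^ α) ^ (1 / (α + 1)) < q := by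
    rw [hq, lt_div_iff₀ hα1]; linarith
  have hXq : m * σ₀ / α ^ α < q ^ (α + 1) := by
    have h1 := Real.rpow_lt_rpow hXr.le hqX hα1
    rwa [← Real.rpow_mul hX.le, one_div_mul_cancel hα1.ne', Real.rpow_one] at h1
  have hkey : m * σ₀ < q * (α * q) ^ α := by
    rw [div_lt_iff₀ hαα, Real.rpow_add hq0, Real.rpow_one] at hXq
    rw [Real.mul_rpow hα0.le hq0.le]
    linarith
  have hk0 : 0 < α * q := by positivity
  have hkα : 0 < (α * q) ^ α := Real.rpow_pos_of_pos hk0 α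
  have hslope : ∀ U ∈ Ioo (0 : ℝ) b, α * q * U = φ U →
      α * q < trajRHS m α γ c h U (φ U) := by
    intro U hU he
    have hU0 := hU.1
    have hU1 : U ≤ 1 := hU.2.le.trans hb.2
    rw [← he]
    unfold trajRHS
    have hUm : 0 < U ^ (m - 1) := Real.rpow_pos_of_pos hU0 _
    have hUα : 0 < U ^ α := Real.rpow_pos_of_pos hU0 _
    have h1 : 0 ≤ γ * m * U ^ (m - 1) * (α * q * U) ^ (1 - α) := by positivity
    have h2 : (m * U ^ (m - 1) * h U) / (α * q * U) ^ α < q := by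
      rw [Real.mul_rpow hk0.le hU0.le, div_lt_iff₀ (by positivity)]
      have h3 : U ^ m ≤ U ^ α := Real.rpow_le_rpow_of_exponent_ge hU0 hU1 hαm.le
      have h4 : U ^ (m - 1) * U = U ^ m := by
        rw [Real.rpow_sub_one hU0.ne']; field_simp
      calc m * U ^ (m - 1) * h U ≤ m * U ^ (m - 1) * (σ₀ * U) := by
            gcongr; exact hσle U ⟨hU0, hU1⟩
        _ = m * σ₀ * U ^ m := by rw [← h4]; ring
        _ ≤ m * σ₀ * U ^ α := by gcongr
        _ < q * (α * q) ^ α * U ^ α := by gcongr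
        _ = _ := by ring
    linarith
  intro U hU
  have hgoal : α * c * U / (α + 1) = α * q * U := by rw [hcq]; field_simp
  rw [hgoal]
  rcases eq_or_lt_of_le hU.1 with h0 | hUpos
  · rw [← h0, mul_zero]; exact hφ0.le
  have hle : 𝓝[Ioo 0 U] (0 : ℝ) ≤ 𝓝[Ico 0 b] 0 :=
    nhdsWithin_mono _ (fun x hx => ⟨hx.1.le, hx.2.trans hU.2⟩)
  have ht : Tendsto (fun x => φ x - α * q * x) (𝓝[Ioo 0 U] (0 : ℝ)) (𝓝 (φ 0 - α * q * 0)) := by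
    apply Tendsto.sub (hφcont.mono_left hle)
    exact ((continuous_const.mul continuous_id).tendsto 0).mono_left nhdsWithin_le_nhds
  have hev := ht.eventually (lt_mem_nhds (by simpa using hφ0 : 0 < φ 0 - α * q * 0))
  have hne : (𝓝[Ioo 0 U] (0 : ℝ)).NeBot := by
    rw [nhdsWithin_Ioo_eq_nhdsGT hUpos]; infer_instance
  obtain ⟨e, he1, he2⟩ := (hev.and self_mem_nhdsWithin).exists
  have hsub : ∀ x ∈ Icc e U, x ∈ Ioo (0 : ℝ) b := fun x hx =>
    ⟨he2.1.trans_le hx.1, hx.2.trans_lt hU.2⟩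
  refine image_le_of_deriv_right_lt_deriv_boundary' (f := fun x => α * q * x)
    (f' := fun _ => α * q) (B := φ) (B' := fun x => trajRHS m α γ c h x (φ x))
    (a := e) (b := U) (by fun_prop) ?_ (by linarith) ?_ ?_ ?_ ⟨he2.2.le, le_rfl⟩
  · intro x _
    simpa using ((hasDerivAt_id x).const_mul (α * q)).hasDerivWithinAt
  · intro x hx
    exact (hφode x (hsub x hx)).continuousAt.continuousWithinAt
  · intro x hx
    exact (hφode x (hsub x ⟨hx.1, hx.2.le⟩)).hasDerivWithinAt
  · intro x hx hxe
    exact hslope x (hsub x ⟨hx.1, hx.2.le⟩) hxe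
end

section
/- Let α > 0, m > 0, σ₀ > 0, γ ≥ 0 and c > 0 satisfy (c/(α+1))^{α+1} α^α + (γ m/(α+1))^{(α+1)/α} α > m σ₀. Define P(z) := z^{α+1} − γ m z − c z^α + m σ₀ and z₀ := ((c α/(α+1))^{α+1} + (γ m/(α+1))^{(α+1)/α})^{1/(α+1)}. Then P(z₀) < 0. -/
open Set Filter Topology

/-- Improved threshold computation with convection: if
`(c/(α+1))^{α+1} α^α + (γm/(α+1))^{(α+1)/α} α > m σ₀`, then the fractional polynomial
`P(z) = z^{α+1} - γ m z - c z^α + m σ₀` is negative at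
`z₀ = ((cα/(α+1))^{α+1} + (γm/(α+1))^{(α+1)/α})^{1/(α+1)}`. -/
theorem statement10 (α m σ₀ γ c : ℝ) (hα : 0 < α) (hm : 0 < m) (hσ : 0 < σ₀)
    (hγ : 0 ≤ γ) (hc : 0 < c)
    (hthresh : m * σ₀ <
      (c / (α + 1)) ^ (α + 1) * α ^ α + (γ * m / (α + 1)) ^ ((α + 1) / α) * α)
    (P : ℝ → ℝ)
    (hP : ∀ z : ℝ, P z = z ^ (α + 1) - γ * m * z - c * z ^ α + m * σ₀)
    (z₀ : ℝ)
    (hz₀ : z₀ = ((c * α / (α + 1)) ^ (α + 1) +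
      (γ * m / (α + 1)) ^ ((α + 1) / α)) ^ (1 / (α + 1))) :
    P z₀ < 0 := by
  have h1 : 0 < α + 1 := by linarith
  obtain ⟨a, ha⟩ : ∃ a, a = c * α / (α + 1) := ⟨_, rfl⟩
  obtain ⟨g, hg⟩ : ∃ g, g = γ * m / (α + 1) := ⟨_, rfl⟩
  have ha0 : 0 < a := by rw [ha]; positivity
  have hg0 : 0 ≤ g := by rw [hg]; positivity
  obtain ⟨b, hb⟩ : ∃ b, b = g ^ (1 / α) := ⟨_, rfl⟩
  have hb0 : 0 ≤ b := by rw [hb]; positivity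
  have hba : b ^ α = g := by
    rw [hb, ← Real.rpow_mul hg0, one_div_mul_cancel hα.ne', Real.rpow_one]
  have hB : g ^ ((α + 1) / α) = b ^ (α + 1) := by
    rw [hb, ← Real.rpow_mul hg0]; congr 1; ring
  have hBg : b ^ (α + 1) = g * b := by
    rw [Real.rpow_add_one' hb0 h1.ne', hba]
  have hA : a ^ (α + 1) = a ^ α * a := Real.rpow_add_one ha0.ne' α
  have hcA : (c / (α + 1)) ^ (α + 1) * α ^ α = a ^ (α + 1) / α := by
    have : c / (α + 1) = a / α := by rw [ha]; field_simp
    rw [this, Real.div_rpow ha0.le hα.le, Real.rpow_add_one hα.ne']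
    have := (Real.rpow_pos_of_pos hα α).ne'
    field_simp
  rw [← ha, ← hg, hB] at hz₀
  rw [← hg, hB, hcA] at hthresh
  have hA0 : 0 ≤ a ^ (α + 1) := by positivity
  have hB0 : 0 ≤ b ^ (α + 1) := by positivity
  have hz0 : 0 ≤ z₀ := by rw [hz₀]; positivity
  have hz : z₀ ^ (α + 1) = a ^ (α + 1) + b ^ (α + 1) := by
    rw [hz₀, ← Real.rpow_mul (by positivity), one_div_mul_cancel h1.ne', Real.rpow_one]
  have haz : a ≤ z₀ := (Real.rpow_le_rpow_iff ha0.le hz0 h1).1 (by linarith)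
  have hbz : b ≤ z₀ := (Real.rpow_le_rpow_iff hb0 hz0 h1).1 (by linarith)
  have haz' : a ^ α ≤ z₀ ^ α := Real.rpow_le_rpow ha0.le haz hα.le
  have e1 : γ * m = (α + 1) * g := by rw [hg]; field_simp
  have e2 : c = (α + 1) * a / α := by rw [ha]; field_simp
  have k1 : γ * m * z₀ ≥ (α + 1) * b ^ (α + 1) := by
    rw [e1, hBg, mul_assoc]; gcongr
  have k2 : c * z₀ ^ α ≥ (α + 1) * a / α * a ^ α := by
    rw [← e2]; gcongr
  have k3 : (α + 1) * a / α * a ^ α = a ^ (α + 1) + a ^ (α + 1) / α := by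
    rw [hA]; field_simp
  rw [hP, hz]
  linarith
end

section
/- Suppose that max_{U∈[0,1]} ∫₀^U f(u) du > 0, where f(u) := m u^{m−1} h(u). Then there exists a constant γ* > 0 such that for every γ ∈ [0, γ*) and every c ≤ 0, there is no solution φ : (0,1) → (0,∞) of the trajectory equation satisfying both lim_{U→0⁺} φ(U) = 0 and lim_{U→1⁻} φ(U) = 0. -/
open Set Filter Topology

theorem aux_le (g g' : ℝ → ℝ) (L : ℝ)
    (hd : ∀ U ∈ Ioo (0 : ℝ) 1, HasDerivAt g (g' U) U)
    (hn : ∀ U ∈ Ioo (0 : ℝ) 1, g' U ≤ 0)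
    (hl : Tendsto g (nhdsWithin 0 (Ioi 0)) (nhds L)) :
    ∀ U ∈ Ioo (0 : ℝ) 1, g U ≤ L := by
  intro U hU
  have hanti : AntitoneOn g (Ioo 0 1) := by
    apply antitoneOn_of_deriv_nonpos (convex_Ioo 0 1)
    · exact fun x hx => (hd x hx).continuousAt.continuousWithinAt
    · rw [interior_Ioo]
      exact fun x hx => (hd x hx).differentiableAt.differentiableWithinAt
    · rw [interior_Ioo]
      intro x hx
      rw [(hd x hx).deriv]
      exact hn x hx
  refine ge_of_tendsto hl ?_
  filter_upwards [Ioo_mem_nhdsGT hU.1] with x hx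
  exact hanti ⟨hx.1, hx.2.trans hU.2⟩ hU hx.2.le

theorem aux_int (m : ℝ) (h : ℝ → ℝ) (hm : 0 < m) (hc : ContinuousOn h (Ici 0))
    (U : ℝ) (hU : 0 ≤ U) :
    IntervalIntegrable (fun u => m * u ^ (m - 1) * h u) MeasureTheory.volume 0 U := by
  have h1 : IntervalIntegrable (fun u : ℝ => m * u ^ (m - 1)) MeasureTheory.volume 0 U :=
    (intervalIntegral.intervalIntegrable_rpow' (by linarith)).const_mul m
  apply h1.mul_continuousOn
  rw [uIcc_of_le hU]
  exact hc.mono (fun x hx => hx.1)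

theorem aux_pick (m : ℝ) (h : ℝ → ℝ) (hm : 0 < m) (hc : ContinuousOn h (Ici 0))
    (hmax : ∃ U ∈ Icc (0 : ℝ) 1, 0 < ∫ u in (0:ℝ)..U, m * u ^ (m - 1) * h u) :
    ∃ U ∈ Ioo (0 : ℝ) 1, 0 < ∫ u in (0:ℝ)..U, m * u ^ (m - 1) * h u := by
  obtain ⟨U, hU, hpos⟩ := hmax
  have hU0 : 0 < U := by
    rcases hU.1.eq_or_lt with h0 | h0
    · rw [← h0] at hpos; simp at hpos
    · exact h0
  have hI := aux_int m h hm hc U hU0.le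
  have hcont : ContinuousOn (fun x => ∫ u in (0:ℝ)..x, m * u ^ (m - 1) * h u) (uIcc 0 U) := by
    apply intervalIntegral.continuousOn_primitive_interval
    rw [uIcc_of_le hU0.le, integrableOn_Icc_iff_integrableOn_Ioc]
    exact (intervalIntegrable_iff_integrableOn_Ioc_of_le hU0.le).1 hI
  rw [uIcc_of_le hU0.le] at hcont
  have hct := hcont U ⟨hU0.le, le_rfl⟩
  have hct2 := (hct.mono (Ioo_subset_Icc_self : Ioo 0 U ⊆ Icc 0 U)).tendsto
  rw [nhdsWithin_Ioo_eq_nhdsLT hU0] at hct2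
  have hev := hct2.eventually (lt_mem_nhds hpos)
  obtain ⟨x, hx, hx2⟩ := (hev.and (Ioo_mem_nhdsLT hU0)).exists
  exact ⟨x, ⟨hx2.1, hx2.2.trans_le hU.2⟩, hx⟩

theorem aux_psi (m α γ c M H U y : ℝ) (hm : 0 < m) (hα : 0 < α) (hγ : 0 ≤ γ) 
    (hc : c ≤ 0) (hU : 0 < U) (hy : 0 < y) :
    (c + γ * m * U ^ (m - 1) * y ^ (1 - α) - (m * U ^ (m - 1) * H) / y ^ α)
      * (α + 1) * y ^ (α + 1 - 1) ≤ (α + 1) * (m * U ^ (m - 1)) * (γ * y - H) := by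
  have e1 : y ^ (1 - α) * y ^ α = y := by
    rw [← Real.rpow_add hy]; simp
  have hp : 0 < y ^ α := Real.rpow_pos_of_pos hy _
  rw [show α + 1 - 1 = α by ring]
  have e2 : (c + γ * m * U ^ (m - 1) * y ^ (1 - α) - (m * U ^ (m - 1) * H) / y ^ α)
      * (α + 1) * y ^ α = (α + 1) * (c * y ^ α + γ * m * U ^ (m - 1) * (y ^ (1 - α) * y ^ α)
        - m * U ^ (m - 1) * H) := by
    field_simp
  rw [e2, e1]
  have : c * y ^ α ≤ 0 := mul_nonpos_of_nonpos_of_nonneg hc hp.le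
  have := mul_le_mul_of_nonneg_left this (by linarith : 0 ≤ α + 1)
  linarith

/-- If `max_{U∈[0,1]} ∫₀^U f > 0` with `f(u) = m u^{m-1} h(u)`, then there is `γ* > 0`
such that for `γ ∈ [0,γ*)` and `c ≤ 0` no positive solution of the trajectory equation
on `(0,1)` connects `(0,0)` to `(1,0)`. -/
theorem statement11 (m p a : ℝ) (α : ℝ) (h : ℝ → ℝ)
    (hm : 0 < m) (hp : 1 < p) (hmp : 1 < m * (p - 1)) (hα : α = 1 / (p - 1))
    (ha0 : 0 ≤ a) (ha1 : a < 1)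
    (hhC1 : ContDiffOn ℝ 1 h (Ici 0))
    (hh0 : h 0 = 0)
    (hhneg : ∀ u ∈ Icc (0 : ℝ) a, h u ≤ 0)
    (hhpos : ∀ u ∈ Ioo a (1 : ℝ), 0 < h u)
    (hhgt : ∀ u : ℝ, 1 < u → h u < 0)
    (hh1 : deriv h 1 < 0)
    (hmax : ∃ U ∈ Icc (0 : ℝ) 1, 0 < ∫ u in (0:ℝ)..U, m * u ^ (m - 1) * h u) :
    ∃ γstar > (0 : ℝ), ∀ γ : ℝ, 0 ≤ γ → γ < γstar → ∀ c : ℝ, c ≤ 0 →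
      ¬ ∃ φ : ℝ → ℝ,
        (∀ U ∈ Ioo (0 : ℝ) 1, 0 < φ U) ∧
        (∀ U ∈ Ioo (0 : ℝ) 1, HasDerivAt φ (trajRHS m α γ c h U (φ U)) U) ∧
        Tendsto φ (nhdsWithin 0 (Ioi 0)) (nhds 0) ∧
        Tendsto φ (nhdsWithin 1 (Iio 1)) (nhds 0) := by
  have hα0 : 0 < α := by rw [hα]; exact one_div_pos.2 (by linarith)
  have hcont : ContinuousOn h (Ici 0) := hhC1.continuousOn
  obtain ⟨U0, hU0, hF⟩ := aux_pick m h hm hcont hmax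
  set F : ℝ → ℝ := fun x => ∫ u in (0:ℝ)..x, m * u ^ (m - 1) * h u with hFdef
  have hF' : 0 < F U0 := hF
  obtain ⟨M, hM⟩ := (isCompact_Icc (a := (0:ℝ)) (b := 1)).exists_bound_of_continuousOn
    (hcont.mono (fun x hx => hx.1))
  have hM0 : 0 ≤ M := (norm_nonneg _).trans (hM 0 ⟨le_rfl, zero_le_one⟩)
  set K := (α + 1) * (1 + M) with hK
  have hK0 : 0 ≤ K := by positivity
  have hFt : Tendsto F (nhdsWithin 0 (Ioi 0)) (nhds 0) := by
    have hI := aux_int m h hm hcont 1 zero_le_one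
    have hcF : ContinuousOn F (uIcc 0 1) := by
      apply intervalIntegral.continuousOn_primitive_interval
      rw [uIcc_of_le zero_le_one, integrableOn_Icc_iff_integrableOn_Ioc]
      exact (intervalIntegrable_iff_integrableOn_Ioc_of_le zero_le_one).1 hI
    rw [uIcc_of_le zero_le_one] at hcF
    have hct := hcF 0 ⟨le_rfl, zero_le_one⟩
    have hct2 := (hct.mono (Ioo_subset_Icc_self : Ioo (0:ℝ) 1 ⊆ Icc 0 1)).tendsto
    rw [nhdsWithin_Ioo_eq_nhdsGT zero_lt_one] at hct2
    have h0 : F 0 = 0 := by simp [hFdef]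
    rwa [h0] at hct2
  have hFd : ∀ U ∈ Ioo (0:ℝ) 1, HasDerivAt F (m * U ^ (m - 1) * h U) U := by
    intro U hU
    have hcU : ContinuousOn (fun u : ℝ => m * u ^ (m - 1) * h u) (Ioi 0) := by
      apply ContinuousOn.mul
      · apply continuousOn_const.mul
        exact ContinuousOn.rpow_const continuousOn_id (fun x hx => Or.inl (ne_of_gt hx))
      · exact hcont.mono Ioi_subset_Ici_self
    apply intervalIntegral.integral_hasDerivAt_right (aux_int m h hm hcont U hU.1.le)
    · exact hcU.stronglyMeasurableAtFilter isOpen_Ioi U hU.1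
    · exact hcU.continuousAt (Ioi_mem_nhds hU.1)
  have hUt : Tendsto (fun U : ℝ => U ^ m) (nhdsWithin 0 (Ioi 0)) (nhds 0) := by
    have := (Real.continuousAt_rpow_const 0 m (Or.inr hm.le)).tendsto
    rw [Real.zero_rpow hm.ne'] at this
    exact this.mono_left nhdsWithin_le_nhds
  refine ⟨min 1 (F U0 / Real.exp K), lt_min one_pos (div_pos hF' (Real.exp_pos _)), ?_⟩
  rintro γ hγ0 hγ c hc ⟨φ, hpos, hder, hlim, -⟩
  have hγ1 : γ ≤ 1 := (hγ.trans_le (min_le_left _ _)).le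
  have hγ2 : γ * Real.exp K < F U0 :=
    (lt_div_iff₀ (Real.exp_pos _)).1 (hγ.trans_le (min_le_right _ _))
  set ψ : ℝ → ℝ := fun U => φ U ^ (α + 1) with hψ
  have hψpos : ∀ U ∈ Ioo (0:ℝ) 1, 0 < ψ U := fun U hU => Real.rpow_pos_of_pos (hpos U hU) _
  have hψd : ∀ U ∈ Ioo (0:ℝ) 1, HasDerivAt ψ
      (trajRHS m α γ c h U (φ U) * (α + 1) * φ U ^ (α + 1 - 1)) U := fun U hU =>
    (hder U hU).rpow_const (Or.inl (hpos U hU).ne')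
  have hψb : ∀ U ∈ Ioo (0:ℝ) 1, trajRHS m α γ c h U (φ U) * (α + 1) * φ U ^ (α + 1 - 1)
      ≤ (α + 1) * (m * U ^ (m - 1)) * (γ * φ U - h U) := fun U hU =>
    aux_psi m α γ c M (h U) U (φ U) hm hα0 hγ0 hc hU.1 (hpos U hU)
  have hψt : Tendsto ψ (nhdsWithin 0 (Ioi 0)) (nhds 0) := by
    have := hlim.rpow_const (p := α + 1) (Or.inr (by linarith))
    rwa [Real.zero_rpow (by linarith)] at this
  have hφψ : ∀ U ∈ Ioo (0:ℝ) 1, φ U ≤ 1 + ψ U := by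
    intro U hU
    rcases le_total (φ U) 1 with h1 | h1
    · linarith [hψpos U hU]
    · have := Real.rpow_le_rpow_of_exponent_le h1 (by linarith : (1:ℝ) ≤ α + 1)
      rw [Real.rpow_one] at this
      have h2 : φ U ≤ ψ U := this
      linarith
  have hUd : ∀ U ∈ Ioo (0:ℝ) 1, HasDerivAt (fun U : ℝ => U ^ m) (m * U ^ (m - 1)) U :=
    fun U hU => Real.hasDerivAt_rpow_const (Or.inl hU.1.ne')
  have hw : ∀ U ∈ Ioo (0:ℝ) 1, 0 < m * U ^ (m - 1) := fun U hU =>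
    mul_pos hm (Real.rpow_pos_of_pos hU.1 _)
  have hlog : ∀ U ∈ Ioo (0:ℝ) 1, Real.log (1 + ψ U) - K * U ^ m ≤ 0 := by
    refine aux_le _ _ 0 (fun U hU => (((hψd U hU).const_add 1).log
      (by linarith [hψpos U hU])).sub ((hUd U hU).const_mul K)) ?_ ?_
    · intro U hU
      have p1 := hψpos U hU
      rw [sub_nonpos, div_le_iff₀ (by linarith)]
      refine (hψb U hU).trans ?_
      have hb := hM U ⟨hU.1.le, hU.2.le⟩
      rw [Real.norm_eq_abs] at hb
      have hb2 := (abs_le.1 hb).1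
      have hp := hpos U hU
      have h3 : γ * φ U - h U ≤ (1 + M) * (1 + ψ U) := by
        have := hφψ U hU
        have h4 : γ * φ U ≤ φ U := by nlinarith
        nlinarith [mul_nonneg hM0 p1.le]
      calc _ ≤ (α + 1) * (m * U ^ (m - 1)) * ((1 + M) * (1 + ψ U)) :=
            mul_le_mul_of_nonneg_left h3 (mul_nonneg (by linarith) (hw U hU).le)
        _ = _ := by rw [hK]; ring
    · have h1 : Tendsto (fun U => Real.log (1 + ψ U)) (nhdsWithin 0 (Ioi 0))
          (nhds (Real.log (1 + 0))) := (hψt.const_add 1).log (by norm_num)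
      have := h1.sub (hUt.const_mul K)
      simpa using this
  have hφb : ∀ U ∈ Ioo (0:ℝ) 1, φ U ≤ Real.exp K := by
    intro U hU
    refine (hφψ U hU).trans ?_
    have p1 := hψpos U hU
    rw [← Real.log_le_iff_le_exp (by linarith)]
    have h1 : U ^ m ≤ 1 := Real.rpow_le_one hU.1.le hU.2.le hm.le
    nlinarith [hlog U hU]
  have hfin : ∀ U ∈ Ioo (0:ℝ) 1,
      ψ U + (α + 1) * F U - (α + 1) * (γ * Real.exp K) * U ^ m ≤ 0 := by
    refine aux_le _ _ 0 (fun U hU => ((hψd U hU).add ((hFd U hU).const_mul (α + 1))).sub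
      ((hUd U hU).const_mul ((α + 1) * (γ * Real.exp K)))) ?_ ?_
    · intro U hU
      have h1 := hψb U hU
      have h2 := mul_le_mul_of_nonneg_left (mul_le_mul_of_nonneg_left (hφb U hU) hγ0)
        (mul_nonneg (by linarith : 0 ≤ α + 1) (hw U hU).le)
      linarith
    · have := (hψt.add (hFt.const_mul (α + 1))).sub
        (hUt.const_mul ((α + 1) * (γ * Real.exp K)))
      simpa using this
  have h1 := hfin U0 hU0
  have h2 := hψpos U0 hU0
  have h3 : U0 ^ m ≤ 1 := Real.rpow_le_one hU0.1.le hU0.2.le hm.le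
  have h4 : γ * Real.exp K * U0 ^ m ≤ γ * Real.exp K :=
    mul_le_of_le_one_right (mul_nonneg hγ0 (Real.exp_pos _).le) h3
  have h5 : 0 ≤ (α + 1) * (F U0 - γ * Real.exp K * U0 ^ m) :=
    mul_nonneg (by linarith) (by linarith)
  linarith
end

section
/- Assume in addition p > 2. Let γ ≥ 0 and c > 0. Then there exist U₁ ∈ (0,1) and a solution φ : (U₁,1) → (0,∞) of the trajectory equation with lim_{U→1⁻} φ(U) = 0, and it satisfies lim_{U→1⁻} φ(U)/(1−U)^{p−1} = (m |h'(1)| / c)^{p−1}. Moreover, any two solutions of the trajectory equation that are positive on a left neighbourhood of U = 1 and tend to 0 as U → 1⁻ coincide on a left neighbourhood of U = 1. -/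
open Set Filter Topology

/-- Global existence for a bounded, globally Lipschitz scalar field on a compact interval. -/
theorem exists_sol_aux (V : ℝ → ℝ → ℝ) (s T x0 M K : ℝ) (hsT : s ≤ T)
    (hcont : ∀ x, ContinuousOn (fun t => V t x) (Icc s T))
    (hlip : ∀ t ∈ Icc s T, ∀ x y, |V t x - V t y| ≤ K * |x - y|)
    (hbd : ∀ t ∈ Icc s T, ∀ x, |V t x| ≤ M) :
    ∃ ψ : ℝ → ℝ, ψ s = x0 ∧ ∀ t ∈ Icc s T, HasDerivWithinAt ψ (V t (ψ t)) (Icc s T) t := by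
  have hP : IsPicardLindelof V (tmin := s) (tmax := T) ⟨s, le_refl s, hsT⟩ x0
      (M.toNNReal * (T - s).toNNReal) 0 M.toNNReal K.toNNReal := by
    constructor
    · intro t ht
      apply LipschitzOnWith.of_dist_le_mul
      intro x _ y _
      rw [Real.dist_eq, Real.dist_eq]
      refine (hlip t ht x y).trans ?_
      gcongr
      exact Real.le_coe_toNNReal K
    · intro x _
      exact hcont x
    · intro t ht x _
      exact (hbd t ht x).trans (Real.le_coe_toNNReal M)
    · have : (0:ℝ) ≤ T - s := by linarith
      simp [this]
  exact hP.exists_eq_forall_mem_Icc_hasDerivWithinAt₀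

/-- Contraction: for a field antitone in the state, distances of solutions decrease. -/
theorem contraction_aux (V : ℝ → ℝ → ℝ) (s T : ℝ)
    (hanti : ∀ t ∈ Icc s T, ∀ x y, x ≤ y → V t y ≤ V t x)
    (ψ χ : ℝ → ℝ)
    (hψ : ∀ t ∈ Icc s T, HasDerivWithinAt ψ (V t (ψ t)) (Icc s T) t)
    (hχ : ∀ t ∈ Icc s T, HasDerivWithinAt χ (V t (χ t)) (Icc s T) t) :
    ∀ t ∈ Icc s T, |ψ t - χ t| ≤ |ψ s - χ s| := by
  intro t ht
  have hA : AntitoneOn (fun t => (ψ t - χ t) ^ 2) (Icc s T) := by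
    apply antitoneOn_of_hasDerivWithinAt_nonpos (convex_Icc s T)
      (f' := fun t => 2 * (ψ t - χ t) * (V t (ψ t) - V t (χ t)))
    · intro t ht
      exact (((hψ t ht).sub (hχ t ht)).pow 2).continuousWithinAt
    · intro t ht
      have ht' := interior_subset ht
      have := (((hψ t ht').sub (hχ t ht')).pow 2).mono interior_subset
      refine HasDerivWithinAt.congr_deriv (f := fun t => (ψ t - χ t) ^ 2) this ?_
      simp
    · intro t ht
      have ht' := interior_subset ht
      rcases le_total (ψ t) (χ t) with h | h
      · have := hanti t ht' _ _ h
        nlinarith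
      · have := hanti t ht' _ _ h
        nlinarith
  have := hA ⟨le_refl s, ht.1.trans ht.2⟩ ht ht.1
  exact sq_le_sq.mp this

/-- Abstract existence between ordered strict barriers which pinch at `t = 0`. -/
theorem abstract_existence (V : ℝ → ℝ → ℝ) (A B A' B' : ℝ → ℝ) (T : ℝ) (hT : 0 < T)
    (hcont : ∀ x, ContinuousOn (fun t => V t x) (Ioc 0 T))
    (hanti : ∀ t ∈ Ioc 0 T, ∀ x y, x ≤ y → V t y ≤ V t x)
    (hlip : ∀ δ, 0 < δ → ∃ K, ∀ t ∈ Icc δ T, ∀ x y, |V t x - V t y| ≤ K * |x - y|)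
    (hbd : ∀ δ, 0 < δ → ∃ M, ∀ t ∈ Icc δ T, ∀ x, |V t x| ≤ M)
    (hA : ∀ t ∈ Ioc 0 T, HasDerivAt A (A' t) t)
    (hB : ∀ t ∈ Ioc 0 T, HasDerivAt B (B' t) t)
    (hA' : ∀ t ∈ Ioc 0 T, A' t < V t (A t))
    (hB' : ∀ t ∈ Ioc 0 T, V t (B t) < B' t)
    (hA0 : ∀ t ∈ Ioc 0 T, 0 ≤ A t)
    (hAB : ∀ t ∈ Ioc 0 T, A t ≤ B t)
    (hBlim : Tendsto B (𝓝[>] 0) (𝓝 0)) :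
    ∃ ψ : ℝ → ℝ, ∀ t ∈ Ioo 0 T, HasDerivAt ψ (V t (ψ t)) t ∧ A t ≤ ψ t ∧ ψ t ≤ B t := by
  set τ : ℕ → ℝ := fun n => T / (n + 1) with hτ
  have hτpos : ∀ n, 0 < τ n := fun n => by positivity
  have hτle : ∀ n, τ n ≤ T := fun n => by
    apply div_le_self hT.le
    have : (0:ℝ) ≤ n := n.cast_nonneg
    linarith
  have hτanti : ∀ n k, n ≤ k → τ k ≤ τ n := fun n k h => by
    have : (n:ℝ) ≤ k := by exact_mod_cast h
    simp only [hτ]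
    gcongr
  have hτlim : Tendsto τ atTop (𝓝 0) := by
    have := (tendsto_one_div_add_atTop_nhds_zero_nat (𝕜 := ℝ)).const_mul T
    simpa [hτ, div_eq_mul_inv] using this
  have hBτ : Tendsto (fun n => B (τ n)) atTop (𝓝 0) :=
    hBlim.comp (tendsto_nhdsWithin_iff.mpr ⟨hτlim, Eventually.of_forall hτpos⟩)
  have hex : ∀ n, ∃ ψ : ℝ → ℝ, ψ (τ n) = B (τ n) ∧
      (∀ t ∈ Icc (τ n) T, HasDerivWithinAt ψ (V t (ψ t)) (Icc (τ n) T) t) := by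
    intro n
    obtain ⟨K, hK⟩ := hlip (τ n) (hτpos n)
    obtain ⟨M, hM⟩ := hbd (τ n) (hτpos n)
    exact exists_sol_aux V (τ n) T _ M K (hτle n)
      (fun x => (hcont x).mono fun t ht => ⟨(hτpos n).trans_le ht.1, ht.2⟩) hK hM
  choose Ψ hΨ0 hΨ using hex
  have hsub : ∀ n t, t ∈ Icc (τ n) T → t ∈ Ioc 0 T :=
    fun n t ht => ⟨(hτpos n).trans_le ht.1, ht.2⟩
  have hder : ∀ n, ∀ t ∈ Ico (τ n) T, HasDerivWithinAt (Ψ n) (V t (Ψ n t)) (Ici t) t := by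
    intro n t ht
    have h1 := (hΨ n t ⟨ht.1, ht.2.le⟩).mono (Icc_subset_Icc_left ht.1)
    exact h1.mono_of_mem_nhdsWithin (Icc_mem_nhdsGE ht.2)
  have hΨc : ∀ n, ContinuousOn (Ψ n) (Icc (τ n) T) := fun n t ht => (hΨ n t ht).continuousWithinAt
  have hup : ∀ n, ∀ t ∈ Icc (τ n) T, Ψ n t ≤ B t := by
    intro n
    refine image_le_of_deriv_right_lt_deriv_boundary' (hΨc n) (hder n) (hΨ0 n).le
      (fun t ht => (hB t (hsub n t ht)).continuousAt.continuousWithinAt)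
      (fun t ht => (hB t (hsub n t ⟨ht.1, ht.2.le⟩)).hasDerivWithinAt) ?_
    intro t ht h
    simp only [h]
    exact hB' t (hsub n t ⟨ht.1, ht.2.le⟩)
  have hlow : ∀ n, ∀ t ∈ Icc (τ n) T, A t ≤ Ψ n t := by
    intro n
    refine image_le_of_deriv_right_lt_deriv_boundary' (f := A) (f' := A') 
      (fun t ht => (hA t (hsub n t ht)).continuousAt.continuousWithinAt)
      (fun t ht => (hA t (hsub n t ⟨ht.1, ht.2.le⟩)).hasDerivWithinAt) ?_ (hΨc n) (hder n) ?_
    · rw [hΨ0]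
      exact hAB _ (hsub n _ ⟨le_refl _, hτle n⟩)
    intro t ht h
    simp only [← h]
    exact hA' t (hsub n t ⟨ht.1, ht.2.le⟩)
  have hcontr : ∀ n k, n ≤ k → ∀ t ∈ Icc (τ n) T, |Ψ n t - Ψ k t| ≤ B (τ n) := by
    intro n k hnk t ht
    have hs : Icc (τ n) T ⊆ Icc (τ k) T := Icc_subset_Icc_left (hτanti n k hnk)
    refine (contraction_aux V (τ n) T (fun t ht => hanti t (hsub n t ht)) (Ψ n) (Ψ k) (hΨ n)
      (fun t ht => (hΨ k t (hs ht)).mono hs) t ht).trans ?_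
    have hmem : τ n ∈ Icc (τ n) T := ⟨le_refl _, hτle n⟩
    have h1 := hup k _ (hs hmem)
    have h2 := hlow k _ (hs hmem)
    have h3 := hA0 _ (hsub n _ hmem)
    rw [hΨ0 n, abs_of_nonneg (by linarith)]
    linarith
  have hlim : ∀ t, ∃ y, t ∈ Ioc 0 T → Tendsto (fun n => Ψ n t) atTop (𝓝 y) := by
    intro t
    by_cases ht : t ∈ Ioc 0 T
    · have hc : CauchySeq (fun n => Ψ n t) := by
        rw [Metric.cauchySeq_iff']
        intro ε hε
        obtain ⟨N, hN1, hN2⟩ :=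
          ((hτlim.eventually (Iio_mem_nhds ht.1)).and (hBτ.eventually (Iio_mem_nhds hε))).exists
        refine ⟨N, fun n hn => ?_⟩
        rw [dist_comm, Real.dist_eq]
        exact (hcontr N n hn t ⟨le_of_lt hN1, ht.2⟩).trans_lt hN2
      obtain ⟨y, hy⟩ := cauchySeq_tendsto_of_complete hc
      exact ⟨y, fun _ => hy⟩
    · exact ⟨0, fun h => absurd h ht⟩
  choose ψ hψ using hlim
  have hclose : ∀ n, ∀ t ∈ Icc (τ n) T, |Ψ n t - ψ t| ≤ B (τ n) := by
    intro n t ht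
    have h1 : Tendsto (fun k => |Ψ n t - Ψ k t|) atTop (𝓝 |Ψ n t - ψ t|) :=
      ((hψ t (hsub n t ht)).const_sub _).abs
    exact le_of_tendsto h1 (eventually_atTop.mpr ⟨n, fun k hk => hcontr n k hk t ht⟩)
  refine ⟨ψ, fun t ht => ⟨?_, ?_, ?_⟩⟩
  · set δ := t / 2 with hδ
    have hδ0 : 0 < δ := by have := ht.1; positivity
    obtain ⟨K, hK⟩ := hlip δ hδ0
    have hev : ∀ᶠ n in atTop, τ n < δ := hτlim.eventually (Iio_mem_nhds hδ0)
    refine hasDerivAt_of_tendstoUniformlyOn (l := atTop) (s := Ioo δ T) (f := Ψ)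
      (f' := fun n t => V t (Ψ n t)) (g' := fun t => V t (ψ t)) isOpen_Ioo ?_ ?_ ?_ ?_
    · rw [Metric.tendstoUniformlyOn_iff]
      intro ε hε
      have h0 : Tendsto (fun n => |K| * B (τ n)) atTop (𝓝 0) := by simpa using hBτ.const_mul |K|
      filter_upwards [hev, h0.eventually (Iio_mem_nhds hε)] with n hn1 hn2 x hx
      rw [dist_comm, Real.dist_eq]
      refine lt_of_le_of_lt ?_ hn2
      calc |V x (Ψ n x) - V x (ψ x)| ≤ K * |Ψ n x - ψ x| := hK x ⟨hx.1.le, hx.2.le⟩ _ _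
        _ ≤ |K| * |Ψ n x - ψ x| := by gcongr; exact le_abs_self K
        _ ≤ |K| * B (τ n) := by
          gcongr
          exact hclose n x ⟨(hn1.trans hx.1).le, hx.2.le⟩
    · filter_upwards [hev] with n hn x hx
      exact (hΨ n x ⟨(hn.trans hx.1).le, hx.2.le⟩).hasDerivAt
        (Icc_mem_nhds (hn.trans hx.1) hx.2)
    · intro x hx
      exact hψ x ⟨hδ0.trans hx.1, hx.2.le⟩
    · have := ht.1
      exact ⟨by rw [hδ]; linarith, ht.2⟩
  · refine ge_of_tendsto (hψ t ⟨ht.1, ht.2.le⟩) ?_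
    filter_upwards [hτlim.eventually (Iio_mem_nhds ht.1)] with n hn
    exact hlow n t ⟨le_of_lt hn, ht.2.le⟩
  · refine le_of_tendsto (hψ t ⟨ht.1, ht.2.le⟩) ?_
    filter_upwards [hτlim.eventually (Iio_mem_nhds ht.1)] with n hn
    exact hup n t ⟨le_of_lt hn, ht.2.le⟩

theorem trajRHS_mono {m α γ c : ℝ} {h : ℝ → ℝ} (hm : 0 < m) (hα0 : 0 < α) (hα1 : α < 1)
    (hγ : 0 ≤ γ) {U x y : ℝ} (hU : 0 < U) (hh : 0 ≤ h U) (hx : 0 < x) (hxy : x ≤ y) :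
    trajRHS m α γ c h U x ≤ trajRHS m α γ c h U y := by
  unfold trajRHS
  have hW : 0 < U ^ (m - 1) := Real.rpow_pos_of_pos hU _
  have h1 : x ^ (1 - α) ≤ y ^ (1 - α) := Real.rpow_le_rpow hx.le hxy (by linarith)
  have h2 : x ^ α ≤ y ^ α := Real.rpow_le_rpow hx.le hxy hα0.le
  have h3 : 0 < x ^ α := Real.rpow_pos_of_pos hx _
  have h4 : γ * m * U ^ (m - 1) * x ^ (1 - α) ≤ γ * m * U ^ (m - 1) * y ^ (1 - α) := by gcongr
  have h5 : (m * U ^ (m - 1) * h U) / y ^ α ≤ (m * U ^ (m - 1) * h U) / x ^ α := by gcongr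
  linarith

/-- Uniqueness near `U = 1`. -/
theorem traj_unique {m α γ c b : ℝ} {h : ℝ → ℝ} (hm : 0 < m) (hα0 : 0 < α) (hα1 : α < 1)
    (hγ : 0 ≤ γ) (hb0 : 0 ≤ b)
    (hhpos : ∀ u ∈ Ioo b (1 : ℝ), 0 ≤ h u) (φ₁ φ₂ : ℝ → ℝ)
    (p1 : ∀ U ∈ Ioo b (1 : ℝ), 0 < φ₁ U)
    (d1 : ∀ U ∈ Ioo b (1 : ℝ), HasDerivAt φ₁ (trajRHS m α γ c h U (φ₁ U)) U)
    (l1 : Tendsto φ₁ (nhdsWithin 1 (Iio 1)) (nhds 0))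
    (p2 : ∀ U ∈ Ioo b (1 : ℝ), 0 < φ₂ U)
    (d2 : ∀ U ∈ Ioo b (1 : ℝ), HasDerivAt φ₂ (trajRHS m α γ c h U (φ₂ U)) U)
    (l2 : Tendsto φ₂ (nhdsWithin 1 (Iio 1)) (nhds 0)) :
    ∀ U ∈ Ioo b (1 : ℝ), φ₁ U = φ₂ U := by
  have hmono : MonotoneOn (fun U => (φ₁ U - φ₂ U) ^ 2) (Ioo b 1) := by
    apply monotoneOn_of_hasDerivWithinAt_nonneg (convex_Ioo b 1)
      (f' := fun t => 2 * (φ₁ t - φ₂ t) *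
        (trajRHS m α γ c h t (φ₁ t) - trajRHS m α γ c h t (φ₂ t)))
    · intro t ht
      exact (((d1 t ht).sub (d2 t ht)).pow 2).continuousAt.continuousWithinAt
    · intro t ht
      rw [interior_Ioo] at ht
      have := (((d1 t ht).sub (d2 t ht)).pow 2).hasDerivWithinAt (s := interior (Ioo b 1))
      refine HasDerivWithinAt.congr_deriv (f := fun t => (φ₁ t - φ₂ t) ^ 2) this ?_
      simp
    · intro t ht
      rw [interior_Ioo] at ht
      have ht0 : 0 < t := hb0.trans_lt ht.1
      rcases le_total (φ₁ t) (φ₂ t) with h' | h'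
      · have := trajRHS_mono (c := c) hm hα0 hα1 hγ ht0 (hhpos t ht) (p1 t ht) h'
        nlinarith
      · have := trajRHS_mono (c := c) hm hα0 hα1 hγ ht0 (hhpos t ht) (p2 t ht) h'
        nlinarith
  intro U hU
  have hlim : Tendsto (fun U => (φ₁ U - φ₂ U) ^ 2) (𝓝[<] 1) (𝓝 0) := by
    simpa using (l1.sub l2).pow 2
  have hle : (φ₁ U - φ₂ U) ^ 2 ≤ 0 := by
    refine ge_of_tendsto hlim ?_
    filter_upwards [Ioo_mem_nhdsLT hU.2] with x hx
    exact hmono hU ⟨hU.1.trans hx.1, hx.2⟩ hx.1.le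
  nlinarith [sq_nonneg (φ₁ U - φ₂ U), pow_eq_zero_iff (two_ne_zero) |>.mp
    (le_antisymm hle (sq_nonneg (φ₁ U - φ₂ U)))]

theorem rpow_lip (e l u : ℝ) (hl : 0 < l) :
    ∃ K, 0 ≤ K ∧ ∀ x ∈ Icc l u, ∀ y ∈ Icc l u, |x ^ e - y ^ e| ≤ K * |x - y| := by
  have hc : ContinuousOn (fun x : ℝ => e * x ^ (e - 1)) (Icc l u) := by
    intro x hx
    have : x ≠ 0 := (hl.trans_le hx.1).ne'
    exact ((Real.continuousAt_rpow_const x (e - 1) (Or.inl this)).const_mul e).continuousWithinAt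
  obtain ⟨K, hK⟩ := isCompact_Icc.exists_bound_of_continuousOn hc
  refine ⟨|K|, abs_nonneg K, fun x hx y hy => ?_⟩
  have := (convex_Icc l u).norm_image_sub_le_of_norm_hasDerivWithin_le (f := fun x : ℝ => x ^ e)
    (f' := fun x : ℝ => e * x ^ (e - 1)) (C := |K|)
    (fun z hz => (Real.hasDerivAt_rpow_const (Or.inl (hl.trans_le hz.1).ne')).hasDerivWithinAt)
    (fun z hz => (hK z hz).trans (le_abs_self K)) hy hx
  simpa [Real.norm_eq_abs] using this

theorem trajRHS_bounds {m α γ c : ℝ} {h : ℝ → ℝ} (hh : ContinuousOn h (Ici 0))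
    {r l u : ℝ} (hr : 0 < r) (hl : 0 < l) :
    ∃ K M, 0 ≤ K ∧ (∀ U ∈ Icc r 1, ∀ x ∈ Icc l u, ∀ y ∈ Icc l u,
      |trajRHS m α γ c h U x - trajRHS m α γ c h U y| ≤ K * |x - y|) ∧
      (∀ U ∈ Icc r 1, ∀ x ∈ Icc l u, |trajRHS m α γ c h U x| ≤ M) := by
  have hW : ContinuousOn (fun U : ℝ => U ^ (m - 1)) (Icc r 1) := fun x hx =>
    (Real.continuousAt_rpow_const x (m - 1)
      (Or.inl (hr.trans_le hx.1).ne')).continuousWithinAt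
  have hH : ContinuousOn h (Icc r 1) := hh.mono fun x hx => hr.le.trans hx.1
  have c1 : ContinuousOn (fun U : ℝ => γ * m * U ^ (m - 1)) (Icc r 1) := by fun_prop
  have c2 : ContinuousOn (fun U : ℝ => m * U ^ (m - 1) * h U) (Icc r 1) := by fun_prop
  obtain ⟨C1, hC1⟩ := isCompact_Icc.exists_bound_of_continuousOn c1
  obtain ⟨C2, hC2⟩ := isCompact_Icc.exists_bound_of_continuousOn c2
  obtain ⟨K1, hK1, hK1'⟩ := rpow_lip (1 - α) l u hl
  obtain ⟨K2, hK2, hK2'⟩ := rpow_lip (-α) l u hl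
  have hneg : ∀ U, ∀ x ∈ Icc l u, trajRHS m α γ c h U x =
      c + γ * m * U ^ (m - 1) * x ^ (1 - α) - m * U ^ (m - 1) * h U * x ^ (-α) := by
    intro U x hx
    rw [trajRHS, Real.rpow_neg (hl.trans_le hx.1).le, div_eq_mul_inv]
  have lip : ∀ U ∈ Icc r 1, ∀ x ∈ Icc l u, ∀ y ∈ Icc l u,
      |trajRHS m α γ c h U x - trajRHS m α γ c h U y| ≤ (|C1| * K1 + |C2| * K2) * |x - y| := by
    intro U hU x hx y hy
    rw [hneg U x hx, hneg U y hy]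
    have e : c + γ * m * U ^ (m - 1) * x ^ (1 - α) - m * U ^ (m - 1) * h U * x ^ (-α) -
        (c + γ * m * U ^ (m - 1) * y ^ (1 - α) - m * U ^ (m - 1) * h U * y ^ (-α)) =
        γ * m * U ^ (m - 1) * (x ^ (1 - α) - y ^ (1 - α)) -
        m * U ^ (m - 1) * h U * (x ^ (-α) - y ^ (-α)) := by ring
    rw [e]
    refine (abs_sub _ _).trans ?_
    rw [abs_mul, abs_mul (m * U ^ (m - 1) * h U), add_mul, mul_assoc |C1|, mul_assoc |C2|]
    have b1 : |γ * m * U ^ (m - 1)| ≤ |C1| := (hC1 U hU).trans (le_abs_self _)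
    have b2 : |m * U ^ (m - 1) * h U| ≤ |C2| := (hC2 U hU).trans (le_abs_self _)
    gcongr
    · exact hK1' x hx y hy
    · exact hK2' x hx y hy
  refine ⟨|C1| * K1 + |C2| * K2, |c| + |C1| * l ^ (1 - α) + |C2| * l ^ (-α) +
    (|C1| * K1 + |C2| * K2) * |u - l|, by positivity, lip, ?_⟩
  intro U hU x hx
  have hll : l ∈ Icc l u := ⟨le_refl l, hx.1.trans hx.2⟩
  have h1 := lip U hU x hx l hll
  have h2 : |trajRHS m α γ c h U l| ≤ |c| + |C1| * l ^ (1 - α) + |C2| * l ^ (-α) := by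
    rw [hneg U l hll]
    refine (abs_sub _ _).trans ?_
    refine (add_le_add_left (abs_add_le _ _) _).trans ?_
    rw [abs_mul, abs_mul (m * U ^ (m - 1) * h U), abs_of_pos (Real.rpow_pos_of_pos hl (1 - α)),
      abs_of_pos (Real.rpow_pos_of_pos hl (-α))]
    have b1 : |γ * m * U ^ (m - 1)| ≤ |C1| := (hC1 U hU).trans (le_abs_self _)
    have b2 : |m * U ^ (m - 1) * h U| ≤ |C2| := (hC2 U hU).trans (le_abs_self _)
    have := Real.rpow_pos_of_pos hl (1 - α)
    have := Real.rpow_pos_of_pos hl (-α)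
    gcongr
  have h3 : |x - l| ≤ |u - l| := by
    rw [abs_of_nonneg (by linarith [hx.1]), abs_of_nonneg (by linarith [hx.1, hx.2])]
    linarith [hx.2]
  have h4 : |trajRHS m α γ c h U x| ≤ |trajRHS m α γ c h U l| +
      |trajRHS m α γ c h U x - trajRHS m α γ c h U l| := by
    have := abs_add_le (trajRHS m α γ c h U l) (trajRHS m α γ c h U x - trajRHS m α γ c h U l)
    simpa using this
  have h5 : (|C1| * K1 + |C2| * K2) * |x - l| ≤ (|C1| * K1 + |C2| * K2) * |u - l| := by gcongr
  linarith

/-- Behaviour of the power barriers. -/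
theorem barrier_lim {m p α γ c k : ℝ} {h : ℝ → ℝ} (hp2 : 2 < p) (hα : α = 1 / (p - 1))
    (hk : 0 < k) (h1 : h 1 = 0) (hd : HasDerivAt h (deriv h 1) 1) :
    Tendsto (fun t => trajRHS m α γ c h (1 - t) ((k * t) ^ (p - 1)) +
      (p - 1) * k * (k * t) ^ (p - 2)) (𝓝[>] 0) (𝓝 (c - m * (-deriv h 1) / k)) := by
  have hq : Tendsto (fun t => h (1 - t) / t) (𝓝[>] 0) (𝓝 (-deriv h 1)) := by
    have hd0 : HasDerivAt (fun t : ℝ => h (1 - t)) (-deriv h 1) 0 := by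
      have h2 : HasDerivAt (fun t : ℝ => 1 - t) (-1) 0 := by
        simpa using (hasDerivAt_id (0:ℝ)).const_sub 1
      have h3 : HasDerivAt h (deriv h 1) ((fun t : ℝ => 1 - t) 0) := by simpa using hd
      exact HasDerivAt.congr_deriv (f := fun t : ℝ => h (1 - t)) (h3.comp (0:ℝ) h2) (by ring)
    have := hd0.tendsto_slope_zero_right
    simp only [zero_add, sub_zero, h1, smul_eq_mul] at this
    refine this.congr fun t => ?_
    rw [div_eq_mul_inv, mul_comm]
  have hpow : Tendsto (fun t => (k * t) ^ (p - 2)) (𝓝[>] 0) (𝓝 0) := by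
    have hc : ContinuousAt (fun t : ℝ => (k * t) ^ (p - 2)) 0 :=
      ContinuousAt.rpow_const (by fun_prop) (Or.inr (by linarith))
    have := hc.tendsto
    simp only [mul_zero, Real.zero_rpow (by linarith : p - 2 ≠ 0)] at this
    exact this.mono_left nhdsWithin_le_nhds
  have hW : Tendsto (fun t : ℝ => (1 - t) ^ (m - 1)) (𝓝[>] 0) (𝓝 1) := by
    have hc : ContinuousAt (fun t : ℝ => (1 - t) ^ (m - 1)) 0 :=
      ContinuousAt.rpow_const (by fun_prop) (Or.inl (by norm_num))
    have := hc.tendsto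
    simp only [sub_zero, Real.one_rpow] at this
    exact this.mono_left nhdsWithin_le_nhds
  have key : Tendsto (fun t => c + γ * m * (1 - t) ^ (m - 1) * (k * t) ^ (p - 2) -
      m * (1 - t) ^ (m - 1) * (h (1 - t) / t) / k + (p - 1) * k * (k * t) ^ (p - 2)) (𝓝[>] 0)
      (𝓝 (c + γ * m * 1 * 0 - m * 1 * (-deriv h 1) / k + (p - 1) * k * 0)) :=
    ((tendsto_const_nhds.add ((hW.const_mul _).mul hpow)).sub
      (((hW.const_mul _).mul hq).div_const k)).add (hpow.const_mul _)
  have e : c + γ * m * 1 * 0 - m * 1 * (-deriv h 1) / k + (p - 1) * k * 0 =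
      c - m * (-deriv h 1) / k := by ring
  rw [e] at key
  refine key.congr' ?_
  filter_upwards [self_mem_nhdsWithin] with t ht
  have ht : 0 < t := ht
  have hkt : 0 ≤ k * t := by positivity
  have hp1 : p - 1 ≠ 0 := by linarith
  rw [trajRHS, ← Real.rpow_mul hkt, ← Real.rpow_mul hkt]
  have e1 : (p - 1) * (1 - α) = p - 2 := by rw [hα]; field_simp; ring
  have e2 : (p - 1) * α = 1 := by rw [hα]; field_simp
  rw [e1, e2, Real.rpow_one]
  field_simp

theorem exists_between_barriers {m p a α γ c k₁ k₂ : ℝ} {h : ℝ → ℝ} (hm : 0 < m)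
    (hα : α = 1 / (p - 1)) (hp2 : 2 < p) (ha0 : 0 ≤ a) (ha1 : a < 1)
    (hhc : ContinuousOn h (Ici 0)) (hhpos : ∀ u ∈ Ioo a (1 : ℝ), 0 < h u)
    (h1 : h 1 = 0) (hd : HasDerivAt h (deriv h 1) 1) (hγ : 0 ≤ γ)
    (hk1 : 0 < k₁) (hk12 : k₁ < k₂)
    (hlow : c - m * (-deriv h 1) / k₁ < 0) (hup : 0 < c - m * (-deriv h 1) / k₂) :
    ∃ U₁ ∈ Ioo a (1 : ℝ), ∃ φ : ℝ → ℝ, ∀ U ∈ Ioo U₁ (1 : ℝ), 0 < φ U ∧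
      HasDerivAt φ (trajRHS m α γ c h U (φ U)) U ∧
      (k₁ * (1 - U)) ^ (p - 1) ≤ φ U ∧ φ U ≤ (k₂ * (1 - U)) ^ (p - 1) := by
  have hk2 : 0 < k₂ := hk1.trans hk12
  have hα0 : 0 < α := by rw [hα]; apply one_div_pos.mpr; linarith
  have hα1 : α < 1 := by rw [hα, div_lt_one] <;> linarith
  have hp1 : 0 < p - 1 := by linarith
  have ev1 := (barrier_lim (m := m) (γ := γ) (c := c) hp2 hα hk1 h1 hd).eventually
    (Iio_mem_nhds hlow)
  have ev2 := (barrier_lim (m := m) (γ := γ) (c := c) hp2 hα hk2 h1 hd).eventually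
    (Ioi_mem_nhds hup)
  obtain ⟨T0, hT0, hT0'⟩ := mem_nhdsGT_iff_exists_Ioo_subset.mp (ev1.and ev2)
  have hT0 : 0 < T0 := hT0
  set T := min T0 (1 - a) / 2 with hTdef
  have hmin : 0 < min T0 (1 - a) := lt_min hT0 (by linarith)
  have hT : 0 < T := by positivity
  have hTT0 : T < T0 := by have := min_le_left T0 (1 - a); linarith
  have hTa : T < 1 - a := by have := min_le_right T0 (1 - a); linarith
  set A : ℝ → ℝ := fun t => (k₁ * t) ^ (p - 1) with hA
  set B : ℝ → ℝ := fun t => (k₂ * t) ^ (p - 1) with hB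
  have hApos : ∀ t, 0 < t → 0 < A t := fun t ht => Real.rpow_pos_of_pos (by positivity) _
  have hAB : ∀ t, 0 < t → A t ≤ B t := fun t ht => by
    simp only [hA, hB]
    exact Real.rpow_le_rpow (by positivity) (by gcongr) hp1.le
  have hder : ∀ k, 0 < k → ∀ t, 0 < t →
      HasDerivAt (fun t => (k * t) ^ (p - 1)) ((p - 1) * k * (k * t) ^ (p - 2)) t := by
    intro k hk t ht
    have h2 : HasDerivAt (fun t : ℝ => k * t) k t := by
      simpa using (hasDerivAt_id t).const_mul k
    refine (h2.rpow_const (p := p - 1) (Or.inl (by positivity))).congr_deriv ?_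
    rw [show p - 1 - 1 = p - 2 by ring]
    ring
  set cl : ℝ → ℝ → ℝ := fun t x => max (A t) (min (B t) x) with hcl
  have hclA : ∀ t x, A t ≤ cl t x := fun t x => le_max_left _ _
  have hclB : ∀ t x, 0 < t → cl t x ≤ B t := fun t x ht => max_le (hAB t ht) (min_le_left _ _)
  have hclid : ∀ t x, A t ≤ x → x ≤ B t → cl t x = x := fun t x h1 h2 => by
    simp only [hcl, min_eq_right h2, max_eq_right h1]
  have hclip : ∀ t x y, |cl t x - cl t y| ≤ |x - y| := fun t x y => by
    refine (abs_max_sub_max_le_max _ _ _ _).trans ?_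
    simp only [sub_self, abs_zero]
    refine max_le (abs_nonneg _) ((abs_min_sub_min_le_max _ _ _ _).trans ?_)
    simp
  have hAmono : ∀ s t, 0 < s → s ≤ t → A s ≤ A t := fun s t hs hst =>
    Real.rpow_le_rpow (by positivity) (by gcongr) hp1.le
  have hBmono : ∀ s t, 0 < s → s ≤ t → B s ≤ B t := fun s t hs hst =>
    Real.rpow_le_rpow (by positivity) (by gcongr) hp1.le
  have hAc : Continuous A := Continuous.rpow_const (by fun_prop) fun _ => Or.inr hp1.le
  have hBc : Continuous B := Continuous.rpow_const (by fun_prop) fun _ => Or.inr hp1.le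
  have hB0 : B 0 = 0 := by simp [hB, Real.zero_rpow hp1.ne']
  have hbounds : ∀ δ, 0 < δ → ∃ K M, 0 ≤ K ∧
      (∀ t ∈ Icc δ T, ∀ x y, |trajRHS m α γ c h (1 - t) (cl t x) -
        trajRHS m α γ c h (1 - t) (cl t y)| ≤ K * |x - y|) ∧
      (∀ t ∈ Icc δ T, ∀ x, |trajRHS m α γ c h (1 - t) (cl t x)| ≤ M) := by
    intro δ hδ
    obtain ⟨K, M, hK, hL, hM⟩ := trajRHS_bounds (m := m) (α := α) (γ := γ) (c := c) hhc
      (r := 1 - T) (l := A δ) (u := B T) (by linarith) (hApos δ hδ)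
    have hmem : ∀ t ∈ Icc δ T, ∀ x, cl t x ∈ Icc (A δ) (B T) := fun t ht x =>
      ⟨(hAmono δ t hδ ht.1).trans (hclA t x),
        (hclB t x (hδ.trans_le ht.1)).trans (hBmono t T (hδ.trans_le ht.1) ht.2)⟩
    have hU : ∀ t ∈ Icc δ T, 1 - t ∈ Icc (1 - T) 1 := fun t ht =>
      ⟨by linarith [ht.2], by linarith [ht.1]⟩
    refine ⟨K, M, hK, fun t ht x y => ?_, fun t ht x => hM _ (hU t ht) _ (hmem t ht x)⟩
    refine (hL _ (hU t ht) _ (hmem t ht x) _ (hmem t ht y)).trans ?_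
    exact mul_le_mul_of_nonneg_left (hclip t x y) hK
  have hkey : ∃ ψ : ℝ → ℝ, ∀ t ∈ Ioo 0 T,
      HasDerivAt ψ (-trajRHS m α γ c h (1 - t) (cl t (ψ t))) t ∧ A t ≤ ψ t ∧ ψ t ≤ B t := by
    refine abstract_existence (fun t x => -trajRHS m α γ c h (1 - t) (cl t x)) A B
      (fun t => (p - 1) * k₁ * (k₁ * t) ^ (p - 2)) (fun t => (p - 1) * k₂ * (k₂ * t) ^ (p - 2))
      T hT ?_ ?_ ?_ ?_ ?_ ?_ ?_ ?_ ?_ ?_ ?_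
    · intro x t ht
      have ht1 : 0 < 1 - t := by linarith [ht.2]
      have hclpos : 0 < cl t x := (hApos t ht.1).trans_le (hclA t x)
      have c1 : ContinuousAt (fun t => cl t x) t := by
        simp only [hcl]
        fun_prop
      have c2 : ContinuousAt (fun t => h (1 - t)) t :=
        ContinuousAt.comp (f := fun t : ℝ => 1 - t) (g := h)
          (hhc.continuousAt (Ici_mem_nhds ht1)) (by fun_prop)
      have c3 : ContinuousAt (fun t : ℝ => (1 - t) ^ (m - 1)) t :=
        ContinuousAt.rpow_const (by fun_prop) (Or.inl ht1.ne')
      have c4 : ContinuousAt (fun t : ℝ => (cl t x) ^ (1 - α)) t :=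
        c1.rpow_const (Or.inl hclpos.ne')
      have c5 : ContinuousAt (fun t : ℝ => (cl t x) ^ α) t :=
        c1.rpow_const (Or.inl hclpos.ne')
      have hne : (cl t x) ^ α ≠ 0 := (Real.rpow_pos_of_pos hclpos _).ne'
      apply ContinuousAt.continuousWithinAt
      unfold trajRHS
      exact ((continuousAt_const.add ((continuousAt_const.mul c3).mul c4)).sub
        (((continuousAt_const.mul c3).mul c2).div c5 hne)).neg
    · intro t ht x y hxy
      have hle : cl t x ≤ cl t y := max_le_max le_rfl (min_le_min le_rfl hxy)
      apply neg_le_neg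
      exact trajRHS_mono hm hα0 hα1 hγ (by linarith [ht.2])
        (hhpos _ ⟨by linarith [ht.2], by linarith [ht.1]⟩).le
        ((hApos t ht.1).trans_le (hclA t x)) hle
    · intro δ hδ
      obtain ⟨K, M, hK, hL, hM⟩ := hbounds δ hδ
      refine ⟨K, fun t ht x y => ?_⟩
      rw [neg_sub_neg, abs_sub_comm]
      exact hL t ht x y
    · intro δ hδ
      obtain ⟨K, M, hK, hL, hM⟩ := hbounds δ hδ
      refine ⟨M, fun t ht x => ?_⟩
      rw [abs_neg]
      exact hM t ht x
    · exact fun t ht => hder k₁ hk1 t ht.1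
    · exact fun t ht => hder k₂ hk2 t ht.1
    · intro t ht
      have : _ < (0:ℝ) := (hT0' ⟨ht.1, ht.2.trans_lt hTT0⟩).1
      simp only [hclid t (A t) le_rfl (hAB t ht.1)]
      simp only [hA]
      linarith
    · intro t ht
      have : (0:ℝ) < _ := (hT0' ⟨ht.1, ht.2.trans_lt hTT0⟩).2
      simp only [hclid t (B t) (hAB t ht.1) le_rfl]
      simp only [hB]
      linarith
    · exact fun t ht => (hApos t ht.1).le
    · exact fun t ht => hAB t ht.1
    · have := hBc.tendsto 0
      rw [hB0] at this
      exact this.mono_left nhdsWithin_le_nhds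
  obtain ⟨ψ, hψ⟩ := hkey
  refine ⟨1 - T, ⟨by linarith, by linarith⟩, fun U => ψ (1 - U), fun U hU => ?_⟩
  have ht : 1 - U ∈ Ioo 0 T := ⟨by linarith [hU.2], by linarith [hU.1]⟩
  obtain ⟨e1, e2, e3⟩ := hψ (1 - U) ht
  refine ⟨(hApos _ ht.1).trans_le e2, ?_, e2, e3⟩
  rw [hclid _ _ e2 e3] at e1
  have h2 : HasDerivAt (fun t : ℝ => 1 - t) (-1) U := by
    simpa using (hasDerivAt_id U).const_sub 1
  refine HasDerivAt.congr_deriv (f := fun t : ℝ => ψ (1 - t)) (e1.comp U h2) ?_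
  simp


/-- Behaviour near `U = 1` of the trajectory through `(1,0)` when `p > 2`: there is a
solution of the trajectory equation on a left neighbourhood of `1` tending to `0` at
`1⁻`, with `φ(U)/(1-U)^{p-1} → (m|h'(1)|/c)^{p-1}`, and any two such solutions
coincide on a left neighbourhood of `1`. -/
theorem statement12 (m p a α γ c : ℝ) (h : ℝ → ℝ)
    (hm : 0 < m) (hp : 1 < p) (hmp : 1 < m * (p - 1)) (hα : α = 1 / (p - 1))
    (hp2 : 2 < p)
    (ha0 : 0 ≤ a) (ha1 : a < 1)
    (hhC1 : ContDiffOn ℝ 1 h (Ici 0))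
    (hh0 : h 0 = 0)
    (hhneg : ∀ u ∈ Icc (0 : ℝ) a, h u ≤ 0)
    (hhpos : ∀ u ∈ Ioo a (1 : ℝ), 0 < h u)
    (hhgt : ∀ u : ℝ, 1 < u → h u < 0)
    (hh1 : deriv h 1 < 0)
    (hγ : 0 ≤ γ) (hc : 0 < c) :
    (∃ U₁ ∈ Ioo (0 : ℝ) 1, ∃ φ : ℝ → ℝ,
      (∀ U ∈ Ioo U₁ (1 : ℝ), 0 < φ U) ∧
      (∀ U ∈ Ioo U₁ (1 : ℝ), HasDerivAt φ (trajRHS m α γ c h U (φ U)) U) ∧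
      Tendsto φ (nhdsWithin 1 (Iio 1)) (nhds 0) ∧
      Tendsto (fun U => φ U / (1 - U) ^ (p - 1)) (nhdsWithin 1 (Iio 1))
        (nhds ((m * |deriv h 1| / c) ^ (p - 1)))) ∧
    (∀ (φ₁ φ₂ : ℝ → ℝ) (a₁ a₂ : ℝ), a₁ ∈ Ioo (0 : ℝ) 1 → a₂ ∈ Ioo (0 : ℝ) 1 →
      (∀ U ∈ Ioo a₁ (1 : ℝ), 0 < φ₁ U) →
      (∀ U ∈ Ioo a₁ (1 : ℝ), HasDerivAt φ₁ (trajRHS m α γ c h U (φ₁ U)) U) →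
      Tendsto φ₁ (nhdsWithin 1 (Iio 1)) (nhds 0) →
      (∀ U ∈ Ioo a₂ (1 : ℝ), 0 < φ₂ U) →
      (∀ U ∈ Ioo a₂ (1 : ℝ), HasDerivAt φ₂ (trajRHS m α γ c h U (φ₂ U)) U) →
      Tendsto φ₂ (nhdsWithin 1 (Iio 1)) (nhds 0) →
      ∃ b ∈ Ioo (0 : ℝ) 1, ∀ U ∈ Ioo b (1 : ℝ), φ₁ U = φ₂ U) := by
  have hα0 : 0 < α := by rw [hα]; apply one_div_pos.mpr; linarith
  have hα1 : α < 1 := by rw [hα, div_lt_one] <;> linarith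
  have hp1 : 0 < p - 1 := by linarith
  have hd : HasDerivAt h (deriv h 1) 1 :=
    (differentiableAt_of_deriv_ne_zero hh1.ne).hasDerivAt
  have hhc : ContinuousOn h (Ici 0) := hhC1.continuousOn
  have h1 : h 1 = 0 := by
    have hct := hd.continuousAt.tendsto
    apply le_antisymm
    · refine le_of_tendsto (hct.mono_left (nhdsWithin_le_nhds (s := Ioi 1))) ?_
      filter_upwards [self_mem_nhdsWithin] with x hx
      exact (hhgt x hx).le
    · refine ge_of_tendsto (hct.mono_left (nhdsWithin_le_nhds (s := Iio 1))) ?_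
      filter_upwards [Ioo_mem_nhdsLT ha1] with x hx
      exact (hhpos x hx).le
  have huniq : ∀ (φ₁ φ₂ : ℝ → ℝ) (a₁ a₂ : ℝ), a₁ ∈ Ioo (0 : ℝ) 1 → a₂ ∈ Ioo (0 : ℝ) 1 →
      (∀ U ∈ Ioo a₁ (1 : ℝ), 0 < φ₁ U) →
      (∀ U ∈ Ioo a₁ (1 : ℝ), HasDerivAt φ₁ (trajRHS m α γ c h U (φ₁ U)) U) →
      Tendsto φ₁ (nhdsWithin 1 (Iio 1)) (nhds 0) →
      (∀ U ∈ Ioo a₂ (1 : ℝ), 0 < φ₂ U) →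
      (∀ U ∈ Ioo a₂ (1 : ℝ), HasDerivAt φ₂ (trajRHS m α γ c h U (φ₂ U)) U) →
      Tendsto φ₂ (nhdsWithin 1 (Iio 1)) (nhds 0) →
      ∃ b ∈ Ioo (0 : ℝ) 1, ∀ U ∈ Ioo b (1 : ℝ), φ₁ U = φ₂ U := by
    intro φ₁ φ₂ a₁ a₂ ha₁ ha₂ p1 d1 l1 p2 d2 l2
    have hb1 : max a (max a₁ a₂) < 1 := max_lt ha1 (max_lt ha₁.2 ha₂.2)
    have hb0 : 0 < max a (max a₁ a₂) := ha₁.1.trans_le ((le_max_left _ _).trans (le_max_right _ _))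
    have i1 : Ioo (max a (max a₁ a₂)) 1 ⊆ Ioo a₁ 1 :=
      Ioo_subset_Ioo_left ((le_max_left _ _).trans (le_max_right _ _))
    have i2 : Ioo (max a (max a₁ a₂)) 1 ⊆ Ioo a₂ 1 :=
      Ioo_subset_Ioo_left ((le_max_right _ _).trans (le_max_right _ _))
    have i0 : Ioo (max a (max a₁ a₂)) 1 ⊆ Ioo a 1 := Ioo_subset_Ioo_left (le_max_left _ _)
    exact ⟨max a (max a₁ a₂), ⟨hb0, hb1⟩, traj_unique hm hα0 hα1 hγ hb0.le
      (fun u hu => (hhpos u (i0 hu)).le) φ₁ φ₂ (fun U hU => p1 U (i1 hU))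
      (fun U hU => d1 U (i1 hU)) l1 (fun U hU => p2 U (i2 hU)) (fun U hU => d2 U (i2 hU)) l2⟩
  refine ⟨?_, huniq⟩
  set η := -deriv h 1 with hη
  have hη0 : 0 < η := by linarith
  set K := m * η / c with hK
  have hK0 : 0 < K := by positivity
  have hKabs : m * |deriv h 1| / c = K := by rw [abs_of_neg hh1]
  rw [hKabs]
  have hexist : ∀ k₁ k₂, 0 < k₁ → k₁ < K → K < k₂ →
      ∃ U₁ ∈ Ioo (0:ℝ) (1 : ℝ), ∃ φ : ℝ → ℝ,
      (∀ U ∈ Ioo U₁ (1 : ℝ), 0 < φ U) ∧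
      (∀ U ∈ Ioo U₁ (1 : ℝ), HasDerivAt φ (trajRHS m α γ c h U (φ U)) U) ∧
      Tendsto φ (nhdsWithin 1 (Iio 1)) (nhds 0) ∧
      (∀ U ∈ Ioo U₁ (1 : ℝ),
        (k₁ * (1 - U)) ^ (p - 1) ≤ φ U ∧ φ U ≤ (k₂ * (1 - U)) ^ (p - 1)) := by
    intro k₁ k₂ hk1 hk1K hKk2
    have hk2 : 0 < k₂ := hK0.trans hKk2
    obtain ⟨U₁, hU₁, φ, hφ⟩ := exists_between_barriers (k₁ := k₁) (k₂ := k₂) (c := c) hm hα hp2 ha0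
      ha1 hhc hhpos h1 hd hγ hk1 (hk1K.trans hKk2)
      (by
        rw [sub_neg, lt_div_iff₀ hk1, mul_comm]
        exact (lt_div_iff₀ hc).mp hk1K)
      (by
        rw [sub_pos, div_lt_iff₀ hk2, mul_comm c]
        exact (div_lt_iff₀ hc).mp hKk2)
    refine ⟨U₁, ⟨ha0.trans_lt hU₁.1, hU₁.2⟩, φ, fun U hU => (hφ U hU).1,
      fun U hU => (hφ U hU).2.1, ?_, fun U hU => (hφ U hU).2.2⟩
    have hc0 : Tendsto (fun U : ℝ => (k₂ * (1 - U)) ^ (p - 1)) (𝓝[<] 1) (𝓝 0) := by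
      have hcc : Continuous (fun U : ℝ => (k₂ * (1 - U)) ^ (p - 1)) :=
        Continuous.rpow_const (by fun_prop) fun _ => Or.inr hp1.le
      have := hcc.tendsto 1
      simp only [sub_self, mul_zero, Real.zero_rpow hp1.ne'] at this
      exact this.mono_left nhdsWithin_le_nhds
    refine tendsto_of_tendsto_of_tendsto_of_le_of_le' tendsto_const_nhds hc0 ?_ ?_
    · filter_upwards [Ioo_mem_nhdsLT hU₁.2] with U hU using (hφ U hU).1.le
    · filter_upwards [Ioo_mem_nhdsLT hU₁.2] with U hU using (hφ U hU).2.2.2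
  obtain ⟨U₁, hU₁, φ, hpos, hder, hlim, -⟩ :=
    hexist (K / 2) (2 * K) (by positivity) (by linarith) (by linarith)
  refine ⟨U₁, hU₁, φ, hpos, hder, hlim, ?_⟩
  have hbds : ∀ k₁ k₂, 0 < k₁ → k₁ < K → K < k₂ → ∀ᶠ U in 𝓝[<] (1:ℝ),
      k₁ ^ (p - 1) ≤ φ U / (1 - U) ^ (p - 1) ∧ φ U / (1 - U) ^ (p - 1) ≤ k₂ ^ (p - 1) := by
    intro k₁ k₂ hk1 hk1K hKk2
    have hk2 : 0 < k₂ := hK0.trans hKk2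
    obtain ⟨V₁, hV₁, χ, hχpos, hχder, hχlim, hχ⟩ := hexist k₁ k₂ hk1 hk1K hKk2
    obtain ⟨b, hb, heq⟩ := huniq φ χ U₁ V₁ hU₁ hV₁ hpos hder hlim hχpos hχder hχlim
    filter_upwards [Ioo_mem_nhdsLT hb.2, Ioo_mem_nhdsLT hV₁.2] with U hU hU'
    have h1U : 0 < 1 - U := by linarith [hU.2]
    have hpw : 0 < (1 - U) ^ (p - 1) := Real.rpow_pos_of_pos h1U _
    have := hχ U hU'
    rw [Real.mul_rpow hk1.le h1U.le, Real.mul_rpow hk2.le h1U.le] at this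
    rw [heq U hU, le_div_iff₀ hpw, div_le_iff₀ hpw]
    exact this
  have hcp : ContinuousAt (fun k : ℝ => k ^ (p - 1)) K :=
    Real.continuousAt_rpow_const K _ (Or.inl hK0.ne')
  rw [tendsto_order]
  constructor
  · intro y hy
    have e1 : ∀ᶠ k in 𝓝[<] K, y < k ^ (p - 1) :=
      (hcp.tendsto.mono_left nhdsWithin_le_nhds).eventually (Ioi_mem_nhds hy)
    obtain ⟨k, hk1, hk2⟩ := (e1.and (Ioo_mem_nhdsLT hK0)).exists
    filter_upwards [hbds k (2 * K) hk2.1 hk2.2 (by linarith)] with U hU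
    exact hk1.trans_le hU.1
  · intro y hy
    have e1 : ∀ᶠ k in 𝓝[>] K, k ^ (p - 1) < y :=
      (hcp.tendsto.mono_left nhdsWithin_le_nhds).eventually (Iio_mem_nhds hy)
    obtain ⟨k, hk1, hk2⟩ := (e1.and self_mem_nhdsWithin).exists
    filter_upwards [hbds (K / 2) k (by positivity) (by linarith) hk2] with U hU
    exact hU.2.trans_lt hk1
end

section
/- Assume in addition 1 < p < 2 (so α > 1) and γ > 0. Let c > 0. Then there exist U₁ ∈ (0,1) and a solution φ : (U₁,1) → (0,∞) of the trajectory equation with lim_{U→1⁻} φ(U) = 0, and it satisfies lim_{U→1⁻} φ(U)/(1−U) = |h'(1)|/γ. Moreover, any two solutions of the trajectory equation that are positive on a left neighbourhood of U = 1 and tend to 0 as U → 1⁻ coincide on a left neighbourhood of U = 1. -/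
open Set Filter Topology

lemma fence {D D' : ℝ → ℝ} {x b : ℝ} (hxb : x ≤ b) (hc : ContinuousOn D (Icc x b))
    (hd : ∀ t ∈ Ico x b, HasDerivAt D (D' t) t)
    (hp : ∀ t ∈ Ico x b, 0 < D t → 0 ≤ D' t) (hb : D b ≤ 0) : D x ≤ 0 := by
  by_contra hx
  push Not at hx
  -- perturb
  have hxb' : x < b := by
    rcases hxb.lt_or_eq with h | h
    · exact h
    · subst h; linarith
  set η : ℝ := D x / (2 * (b - x)) with hη
  have hbx : 0 < b - x := by linarith
  have hηp : 0 < η := by positivity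
  have hηe : η * (b - x) = D x / 2 := by rw [hη]; field_simp
  have key := image_le_of_deriv_right_lt_deriv_boundary' (f := fun t => -(D t))
    (f' := fun t => -(D' t)) (a := x) (b := b) hc.neg
    (fun t ht => (hd t ht).neg.hasDerivWithinAt)
    (B := fun t => -(D x) + η * (t - x)) (B' := fun t => η) (by simp)
    (by fun_prop)
    (fun t ht => by
      have : HasDerivAt (fun t => -(D x) + η * (t - x)) (η * 1) t :=
        (((hasDerivAt_id t).sub_const x).const_mul η).const_add _
      simpa using this.hasDerivWithinAt)
    (fun t ht he => by
      have h1 : η * (t - x) ≤ η * (b - x) :=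
        mul_le_mul_of_nonneg_left (by linarith [ht.2]) hηp.le
      have he' : -(D t) = -(D x) + η * (t - x) := he
      have := hp t ht (by linarith)
      show -(D' t) < η
      linarith)
  have := key (right_mem_Icc.2 hxb)
  have h2 : -(D b) ≤ -(D x) + η * (b - x) := this
  linarith

lemma fence_sing {D D' : ℝ → ℝ} {a : ℝ}
    (hd : ∀ t ∈ Ioo a 1, HasDerivAt D (D' t) t)
    (hp : ∀ t ∈ Ioo a 1, 0 < D t → 0 ≤ D' t) (hl : Tendsto D (𝓝[<] 1) (𝓝 0)) :
    ∀ x ∈ Ioo a 1, D x ≤ 0 := by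
  intro x hx
  by_contra hDx
  push Not at hDx
  have h1 : ∀ᶠ t in 𝓝[<] (1:ℝ), D t < D x / 2 := hl.eventually (gt_mem_nhds (by linarith))
  have h2 : ∀ᶠ t in 𝓝[<] (1:ℝ), t ∈ Ioo x 1 := Ioo_mem_nhdsLT hx.2
  obtain ⟨b, hb1, hb2⟩ := (h1.and h2).exists
  have := fence (D := fun t => D t - D x / 2) (D' := D') hb2.1.le
    (fun t ht => ((hd t ⟨by linarith [hx.1, ht.1], by linarith [hb2.2, ht.2]⟩).sub_const
      _).continuousAt.continuousWithinAt)
    (fun t ht => (hd t ⟨by linarith [hx.1, ht.1], by linarith [hb2.2, ht.2]⟩).sub_const _)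
    (fun t ht h0 => hp t ⟨by linarith [hx.1, ht.1], by linarith [hb2.2, ht.2]⟩ (by linarith))
    (by linarith)
  linarith

lemma exists_sol_compact (F : ℝ → ℝ → ℝ) (u b y0 : ℝ) (hub : u < b) (K : NNReal) (L : ℝ)
    (hK : ∀ t ∈ Icc u b, ∀ y z, |F t y - F t z| ≤ K * |y - z|)
    (hcont : ∀ y, ContinuousOn (fun t => F t y) (Icc u b))
    (hL : ∀ t ∈ Icc u b, ∀ y, |F t y| ≤ L) :
    ∃ φ : ℝ → ℝ, φ b = y0 ∧ ContinuousOn φ (Icc u b) ∧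
      ∀ t ∈ Ioo u b, HasDerivAt φ (F t (φ t)) t := by
  have hL0 : 0 ≤ L := (abs_nonneg _).trans (hL b ⟨hub.le, le_rfl⟩ 0)
  have hPL : IsPicardLindelof F (⟨b, hub.le, le_rfl⟩ : Icc u b) y0
      (⟨L * (b - u), mul_nonneg hL0 (by linarith)⟩) 0 ⟨L, hL0⟩ K := by
    refine ⟨?_, ?_, ?_, ?_⟩
    · intro t ht
      refine LipschitzOnWith.of_dist_le_mul fun y _ z _ => ?_
      simpa [Real.dist_eq] using hK t ht y z
    · intro y _
      exact hcont y
    · intro t ht y _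
      exact hL t ht y
    · simp only [sub_self, NNReal.coe_zero, sub_zero]
      rw [max_eq_right (by linarith)]
      exact le_rfl
  obtain ⟨φ, h1, h2⟩ := hPL.exists_eq_forall_mem_Icc_hasDerivWithinAt₀
  exact ⟨φ, h1, fun t ht => (h2 t ht).continuousWithinAt,
    fun t ht => (h2 t ⟨ht.1.le, ht.2.le⟩).hasDerivAt (Icc_mem_nhds ht.1 ht.2)⟩

lemma exists_sol (F : ℝ → ℝ → ℝ) (u : ℝ) (hu : u < 1) (ℓ g ℓ' g' : ℝ → ℝ)
    (hK : ∀ b ∈ Ioo u 1, ∃ K : NNReal, ∀ t ∈ Icc u b, ∀ y z, |F t y - F t z| ≤ K * |y - z|)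
    (hcont : ∀ y, ContinuousOn (fun t => F t y) (Ico u 1))
    (hL : ∀ b ∈ Ioo u 1, ∃ L : ℝ, ∀ t ∈ Icc u b, ∀ y, |F t y| ≤ L)
    (hmono : ∀ t ∈ Ico u 1, Monotone (F t))
    (hℓ0 : ∀ t ∈ Ico u 1, 0 ≤ ℓ t)
    (hℓg : ∀ t ∈ Ico u 1, ℓ t ≤ g t)
    (hg0 : Tendsto g (𝓝[<] 1) (𝓝 0))
    (hg' : ∀ t ∈ Ico u 1, HasDerivAt g (g' t) t)
    (hℓ' : ∀ t ∈ Ico u 1, HasDerivAt ℓ (ℓ' t) t)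
    (hFg : ∀ t ∈ Ico u 1, g' t ≤ F t (g t))
    (hFℓ : ∀ t ∈ Ico u 1, F t (ℓ t) ≤ ℓ' t) :
    ∃ φ : ℝ → ℝ, ∀ t ∈ Ioo u 1, ℓ t ≤ φ t ∧ φ t ≤ g t ∧ HasDerivAt φ (F t (φ t)) t := by
  set b : ℕ → ℝ := fun n => 1 - (1 - u) / (n + 2) with hbdef
  have hbm : ∀ n, b n ∈ Ioo u 1 := by
    intro n
    have hn : (0:ℝ) ≤ n := n.cast_nonneg
    have h1 : (1 - u) / ((n:ℝ) + 2) < 1 - u := by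
      apply div_lt_self <;> linarith
    have h2 : 0 < (1 - u) / ((n:ℝ) + 2) := by
      apply div_pos <;> linarith
    constructor <;> simp only [hbdef] <;> linarith
  have hbmono : Monotone b := by
    intro i j hij
    have hi : (0:ℝ) ≤ i := i.cast_nonneg
    have hij' : (i:ℝ) ≤ j := by exact_mod_cast hij
    simp only [hbdef]
    have : (1 - u) / ((j:ℝ) + 2) ≤ (1 - u) / ((i:ℝ) + 2) := by
      apply div_le_div_of_nonneg_left <;> linarith
    linarith
  have hblim : Tendsto b atTop (𝓝 1) := by
    have h1 : Tendsto (fun n : ℕ => (n:ℝ) + 2) atTop atTop :=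
      tendsto_atTop_add_const_right _ _ tendsto_natCast_atTop_atTop
    have h2 := (h1.const_div_atTop (1 - u)).const_sub 1
    simpa [hbdef] using h2
  have hblim' : Tendsto b atTop (𝓝[<] 1) :=
    tendsto_nhdsWithin_iff.2 ⟨hblim, Eventually.of_forall fun n => (hbm n).2⟩
  have hgb : Tendsto (fun n => g (b n)) atTop (𝓝 0) := hg0.comp hblim'
  have hsol : ∀ n, ∃ φ : ℝ → ℝ, φ (b n) = g (b n) ∧ ContinuousOn φ (Icc u (b n)) ∧
      ∀ t ∈ Ioo u (b n), HasDerivAt φ (F t (φ t)) t := by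
    intro n
    obtain ⟨K, hK⟩ := hK (b n) (hbm n)
    obtain ⟨L, hL⟩ := hL (b n) (hbm n)
    exact exists_sol_compact F u (b n) (g (b n)) (hbm n).1 K L hK
      (fun y => (hcont y).mono (fun t ht => ⟨ht.1, ht.2.trans_lt (hbm n).2⟩)) hL
  choose φ hφb hφc hφd using hsol
  have hsub : ∀ n, ∀ t, t ∈ Ioc u (b n) → t ∈ Ico u 1 :=
    fun n t ht => ⟨ht.1.le, ht.2.trans_lt (hbm n).2⟩
  have hgc : ∀ n, ContinuousOn g (Icc u (b n)) := fun n t ht =>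
    (hg' t ⟨ht.1, ht.2.trans_lt (hbm n).2⟩).continuousAt.continuousWithinAt
  have hℓc : ∀ n, ContinuousOn ℓ (Icc u (b n)) := fun n t ht =>
    (hℓ' t ⟨ht.1, ht.2.trans_lt (hbm n).2⟩).continuousAt.continuousWithinAt
  have hup : ∀ n, ∀ x ∈ Ioc u (b n), φ n x ≤ g x := by
    intro n x hx
    have := fence (D := fun t => φ n t - g t) (D' := fun t => F t (φ n t) - g' t) hx.2
      (((hφc n).sub (hgc n)).mono (Icc_subset_Icc_left hx.1.le))
      (fun t ht => (hφd n t ⟨hx.1.trans_le ht.1, ht.2⟩).sub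
        (hg' t (hsub n t ⟨hx.1.trans_le ht.1, ht.2.le⟩)))
      (fun t ht h0 => by
        have hm := hsub n t ⟨hx.1.trans_le ht.1, ht.2.le⟩
        have h1 := hmono t hm (show g t ≤ φ n t by linarith)
        have h2 := hFg t hm
        show 0 ≤ F t (φ n t) - g' t
        linarith)
      (by simp [hφb n])
    linarith
  have hlo : ∀ n, ∀ x ∈ Ioc u (b n), ℓ x ≤ φ n x := by
    intro n x hx
    have := fence (D := fun t => ℓ t - φ n t) (D' := fun t => ℓ' t - F t (φ n t)) hx.2
      (((hℓc n).sub (hφc n)).mono (Icc_subset_Icc_left hx.1.le))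
      (fun t ht => (hℓ' t (hsub n t ⟨hx.1.trans_le ht.1, ht.2.le⟩)).sub
        (hφd n t ⟨hx.1.trans_le ht.1, ht.2⟩))
      (fun t ht h0 => by
        have hm := hsub n t ⟨hx.1.trans_le ht.1, ht.2.le⟩
        have h1 := hmono t hm (show φ n t ≤ ℓ t by linarith)
        have h2 := hFℓ t hm
        show 0 ≤ ℓ' t - F t (φ n t)
        linarith)
      (by
        have := hℓg (b n) (hsub n _ ⟨(hbm n).1, le_rfl⟩)
        simp only [hφb n]; linarith)
    linarith
  -- contraction
  have hcmp : ∀ i j e x, e ≤ i → e ≤ j → x ∈ Ioc u (b e) →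
      φ i x - φ j x ≤ g (b e) := by
    intro i j e x hi hj hx
    have hbi := hbmono hi
    have hbj := hbmono hj
    have hbe : b e ∈ Ico u 1 := hsub e _ ⟨(hbm e).1, le_rfl⟩
    have := fence (D := fun t => φ i t - φ j t - g (b e))
      (D' := fun t => F t (φ i t) - F t (φ j t)) hx.2
      (((((hφc i).mono (Icc_subset_Icc_right hbi)).sub
        ((hφc j).mono (Icc_subset_Icc_right hbj))).sub continuousOn_const).mono
          (Icc_subset_Icc_left hx.1.le))
      (fun t ht => ((hφd i t ⟨hx.1.trans_le ht.1, ht.2.trans_le hbi⟩).sub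
        (hφd j t ⟨hx.1.trans_le ht.1, ht.2.trans_le hbj⟩)).sub_const _)
      (fun t ht h0 => by
        have hm := hsub e t ⟨hx.1.trans_le ht.1, ht.2.le⟩
        have h3 : 0 ≤ g (b e) := (hℓ0 _ hbe).trans (hℓg _ hbe)
        have h1 := hmono t hm (show φ j t ≤ φ i t by linarith)
        show 0 ≤ F t (φ i t) - F t (φ j t)
        linarith)
      (by
        have h1 := hup i (b e) ⟨(hbm e).1, hbi⟩
        have h2 := hlo j (b e) ⟨(hbm e).1, hbj⟩
        have h3 := hℓ0 _ hbe
        show φ i (b e) - φ j (b e) - g (b e) ≤ 0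
        linarith)
    linarith
  have hev : ∀ x ∈ Ioo u 1, ∃ N, ∀ n, N ≤ n → x < b n := by
    intro x hx
    exact eventually_atTop.1 (hblim.eventually (lt_mem_nhds hx.2))
  have hlim : ∀ x, ∃ y, x ∈ Ioo u 1 → Tendsto (fun n => φ n x) atTop (𝓝 y) := by
    intro x
    by_cases hx : x ∈ Ioo u 1
    · obtain ⟨N, hN⟩ := hev x hx
      have hC : CauchySeq (fun n => φ n x) := by
        rw [Metric.cauchySeq_iff]
        intro ε hε
        obtain ⟨e, he1, he2⟩ := ((hgb.eventually (gt_mem_nhds hε)).and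
          (eventually_ge_atTop N)).exists
        refine ⟨e, fun i hi j hj => ?_⟩
        rw [Real.dist_eq, abs_lt]
        have h1 := hcmp i j e x hi hj ⟨hx.1, (hN e he2).le⟩
        have h2 := hcmp j i e x hj hi ⟨hx.1, (hN e he2).le⟩
        constructor <;> linarith
      obtain ⟨y, hy⟩ := cauchySeq_tendsto_of_complete hC
      exact ⟨y, fun _ => hy⟩
    · exact ⟨0, fun h => absurd h hx⟩
  choose ψ hψ using hlim
  refine ⟨ψ, fun t ht => ?_⟩
  obtain ⟨N, hN⟩ := hev t ht
  have hdist : ∀ n x, x ∈ Ioc u (b n) → |φ n x - ψ x| ≤ g (b n) := by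
    intro n x hx
    have hx1 : x ∈ Ioo u 1 := ⟨hx.1, hx.2.trans_lt (hbm n).2⟩
    have hl : Tendsto (fun j => |φ n x - φ j x|) atTop (𝓝 |φ n x - ψ x|) :=
      ((hψ x hx1).const_sub _).abs
    refine le_of_tendsto hl ?_
    filter_upwards [eventually_ge_atTop n] with j hj
    rw [abs_le]
    have h1 := hcmp n j n x le_rfl hj hx
    have h2 := hcmp j n n x hj le_rfl hx
    constructor <;> linarith
  refine ⟨ge_of_tendsto (hψ t ht) ?_, le_of_tendsto (hψ t ht) ?_, ?_⟩
  · filter_upwards [eventually_ge_atTop N] with n hn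
    exact hlo n t ⟨ht.1, (hN n hn).le⟩
  · filter_upwards [eventually_ge_atTop N] with n hn
    exact hup n t ⟨ht.1, (hN n hn).le⟩
  · obtain ⟨K, hK⟩ := hK (b N) (hbm N)
    refine hasDerivAt_of_tendstoUniformlyOn (l := atTop) (s := Ioo u (b N)) isOpen_Ioo
      (f := φ) (f' := fun n x => F x (φ n x)) (g := ψ) (g' := fun x => F x (ψ x)) ?_ ?_ ?_
      ⟨ht.1, hN N le_rfl⟩
    · rw [Metric.tendstoUniformlyOn_iff]
      intro ε hε
      have hKg : Tendsto (fun n => K * g (b n)) atTop (𝓝 (K * 0)) := hgb.const_mul _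
      rw [mul_zero] at hKg
      filter_upwards [hKg.eventually (gt_mem_nhds hε), eventually_ge_atTop N] with n hn hnN x hx
      rw [dist_comm, Real.dist_eq]
      refine lt_of_le_of_lt ((hK x ⟨hx.1.le, hx.2.le⟩ _ _).trans ?_) hn
      exact mul_le_mul_of_nonneg_left (hdist n x ⟨hx.1, hx.2.le.trans (hbmono hnN)⟩) K.2
    · filter_upwards [eventually_ge_atTop N] with n hn x hx
      exact hφd n x ⟨hx.1, hx.2.trans_le (hbmono hn)⟩
    · intro x hx
      exact hψ x ⟨hx.1, hx.2.trans (hbm N).2⟩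

lemma rhs_eq (m α γ c : ℝ) (h : ℝ → ℝ) (U y : ℝ) (hy : 0 < y) :
    trajRHS m α γ c h U y = c - m * U ^ (m - 1) * (y ^ (-α) * (h U - γ * y)) := by
  unfold trajRHS
  have h1 : y ^ (1 - α) = y * y ^ (-α) := by
    rw [sub_eq_add_neg, Real.rpow_add hy, Real.rpow_one]
  have h2 : y ^ α ≠ 0 := (Real.rpow_pos_of_pos hy _).ne'
  rw [h1, div_eq_mul_inv, ← Real.rpow_neg hy.le]
  ring

lemma core_anti {α γ H y z : ℝ} (hα : 0 < α) (hγ : 0 < γ) (hy : 0 < y) (hyz : y ≤ z)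
    (hz : γ * z ≤ H) : z ^ (-α) * (H - γ * z) ≤ y ^ (-α) * (H - γ * y) := by
  have h1 : z ^ (-α) ≤ y ^ (-α) :=
    Real.rpow_le_rpow_of_nonpos hy hyz (by linarith)
  have h2 : γ * y ≤ γ * z := mul_le_mul_of_nonneg_left hyz hγ.le
  exact mul_le_mul h1 (by linarith) (by linarith) (Real.rpow_nonneg hy.le _)

lemma rhs_mono {m α γ c : ℝ} {h : ℝ → ℝ} {U y z : ℝ} (hm : 0 < m) (hU : 0 < U) (hα : 0 < α)
    (hγ : 0 < γ) (hy : 0 < y) (hyz : y ≤ z) (hz : z ≤ h U / γ) :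
    trajRHS m α γ c h U y ≤ trajRHS m α γ c h U z := by
  rw [rhs_eq _ _ _ _ _ _ _ hy, rhs_eq _ _ _ _ _ _ _ (hy.trans_le hyz)]
  have hz' : γ * z ≤ h U := by rw [le_div_iff₀ hγ] at hz; linarith
  have h1 := core_anti hα hγ hy hyz hz'
  have h2 : 0 ≤ m * U ^ (m - 1) := mul_nonneg hm.le (Real.rpow_nonneg hU.le _)
  have := mul_le_mul_of_nonneg_left h1 h2
  linarith

lemma rhs_ge_c {m α γ c : ℝ} {h : ℝ → ℝ} {U y : ℝ} (hm : 0 < m) (hU : 0 < U)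
    (hγ : 0 < γ) (hy : 0 < y) (hz : h U / γ ≤ y) :
    c ≤ trajRHS m α γ c h U y := by
  rw [rhs_eq _ _ _ _ _ _ _ hy]
  have hz' : h U ≤ γ * y := by rw [div_le_iff₀ hγ] at hz; linarith
  have h2 : 0 ≤ m * U ^ (m - 1) := mul_nonneg hm.le (Real.rpow_nonneg hU.le _)
  have h3 : 0 ≤ y ^ (-α) * (γ * y - h U) :=
    mul_nonneg (Real.rpow_nonneg hy.le _) (by linarith)
  have := mul_nonneg h2 h3
  nlinarith

/-- Upper bound of the right-hand side below the line `θ h / γ`. -/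
lemma rhs_le {m α γ c θ : ℝ} {h : ℝ → ℝ} {U y : ℝ} (hm : 0 < m) (hU : 0 < U) (hα : 0 < α)
    (hγ : 0 < γ) (hy : 0 < y) (hθ1 : θ < 1) (hH : 0 < h U) (hz : y ≤ θ * (h U / γ)) :
    trajRHS m α γ c h U y ≤
      c - m * U ^ (m - 1) * ((1 - θ) * γ * (h U / γ) ^ (1 - α)) := by
  rw [rhs_eq _ _ _ _ _ _ _ hy]
  have hg : 0 < h U / γ := div_pos hH hγ
  have hyg : y ≤ h U / γ := hz.trans (by nlinarith)
  have h1 : (h U / γ) ^ (-α) ≤ y ^ (-α) := Real.rpow_le_rpow_of_nonpos hy hyg (by linarith)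
  have h2 : 0 ≤ m * U ^ (m - 1) := mul_nonneg hm.le (Real.rpow_nonneg hU.le _)
  have h3 : (h U / γ) ^ (1 - α) = (h U / γ) * (h U / γ) ^ (-α) := by
    rw [sub_eq_add_neg, Real.rpow_add hg, Real.rpow_one]
  have h4 : (1 - θ) * γ * (h U / γ) ≤ h U - γ * y := by
    have e : γ * (h U / γ) = h U := by field_simp
    have := mul_le_mul_of_nonneg_left hz hγ.le
    nlinarith
  have h5 : 0 ≤ (1 - θ) * γ * (h U / γ) :=
    mul_nonneg (mul_nonneg (by linarith) hγ.le) hg.le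
  have h6 := mul_le_mul h1 h4 h5 (Real.rpow_nonneg hy.le _)
  have h7 := mul_le_mul_of_nonneg_left h6 h2
  rw [h3]
  nlinarith

lemma rpow_lip_s13 {r δ : ℝ} (hr : r ≤ 0) (hδ : 0 < δ) :
    ∀ x y, δ ≤ x → δ ≤ y → |x ^ r - y ^ r| ≤ |r| * δ ^ (r - 1) * |x - y| := by
  intro x y hx hy
  have := Convex.norm_image_sub_le_of_norm_hasDerivWithin_le (f := fun x : ℝ => x ^ r)
    (f' := fun x => r * x ^ (r - 1)) (s := Ici δ) (C := |r| * δ ^ (r - 1)) (x := y) (y := x)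
    (fun z hz => (Real.hasDerivAt_rpow_const (Or.inl (hδ.trans_le hz).ne')).hasDerivWithinAt)
    (fun z hz => by
      rw [norm_mul, Real.norm_eq_abs, Real.norm_eq_abs,
        abs_of_nonneg (Real.rpow_nonneg (hδ.trans_le hz).le _)]
      exact mul_le_mul_of_nonneg_left
        (Real.rpow_le_rpow_of_nonpos hδ hz (by linarith)) (abs_nonneg _))
    (convex_Ici δ) hy hx
  simpa [Real.norm_eq_abs] using this

lemma setup (m a : ℝ) (h : ℝ → ℝ) (hm : 0 < m) (ha1 : a < 1)
    (hhC1 : ContDiffOn ℝ 1 h (Ici 0))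
    (hhpos : ∀ u ∈ Ioo a (1 : ℝ), 0 < h u)
    (hhgt : ∀ u : ℝ, 1 < u → h u < 0)
    (hh1 : deriv h 1 < 0) :
    h 1 = 0 ∧ Tendsto h (𝓝[<] 1) (𝓝 0) ∧
    Tendsto (fun U => h U / (1 - U)) (𝓝[<] 1) (𝓝 |deriv h 1|) ∧
    ∃ M : ℝ, ∀ᶠ U in 𝓝[<] (1:ℝ), 0 < U ∧ HasDerivAt h (deriv h U) U ∧ deriv h U ≤ 0 ∧
      -M ≤ deriv h U ∧ 0 < h U ∧ m / 2 ≤ m * U ^ (m - 1) := by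
  have hd1 : HasDerivAt h (deriv h 1) 1 :=
    (differentiableAt_of_deriv_ne_zero hh1.ne).hasDerivAt
  have hc1 := hd1.continuousAt
  have h10 : h 1 = 0 := by
    apply le_antisymm
    · have ht : Tendsto h (𝓝[>] 1) (𝓝 (h 1)) := hc1.tendsto.mono_left nhdsWithin_le_nhds
      refine le_of_tendsto ht ?_
      filter_upwards [self_mem_nhdsWithin] with u hu
      exact (hhgt u hu).le
    · have ht : Tendsto h (𝓝[<] 1) (𝓝 (h 1)) := hc1.tendsto.mono_left nhdsWithin_le_nhds
      refine ge_of_tendsto ht ?_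
      filter_upwards [Ioo_mem_nhdsLT ha1] with u hu
      exact (hhpos u hu).le
  have hdc : ContinuousAt (deriv h) 1 :=
    ((hhC1.mono Ioi_subset_Ici_self).continuousOn_deriv_of_isOpen isOpen_Ioi le_rfl).continuousAt
      (Ioi_mem_nhds one_pos)
  refine ⟨h10, ?_, ?_, -(deriv h 1 - 1), ?_⟩
  · have ht : Tendsto h (𝓝[<] 1) (𝓝 (h 1)) := hc1.tendsto.mono_left nhdsWithin_le_nhds
    rwa [h10] at ht
  · have hs := (hasDerivAt_iff_tendsto_slope.1 hd1).mono_left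
      (nhdsWithin_mono (1:ℝ) (fun x (hx : x < 1) => hx.ne))
    rw [abs_of_neg hh1]
    refine hs.neg.congr' ?_
    filter_upwards [self_mem_nhdsWithin] with u hu
    have hu' : u < 1 := hu
    have e1 : u - 1 ≠ 0 := by linarith
    have e2 : 1 - u ≠ 0 := by linarith
    rw [slope_def_field, h10]
    field_simp
    ring
  · have hA : ContinuousAt (fun U : ℝ => m * U ^ (m - 1)) 1 :=
      continuousAt_const.mul (Real.continuousAt_rpow_const _ _ (Or.inl one_ne_zero))
    have hA1 : m / 2 < m * (1:ℝ) ^ (m - 1) := by rw [Real.one_rpow]; linarith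
    filter_upwards [Ioo_mem_nhdsLT ha1, Ioo_mem_nhdsLT (zero_lt_one' ℝ),
      nhdsWithin_le_nhds (hdc.eventually (gt_mem_nhds hh1)),
      nhdsWithin_le_nhds (hdc.eventually (lt_mem_nhds (show deriv h 1 - 1 < deriv h 1 by linarith))),
      nhdsWithin_le_nhds (hA.eventually (lt_mem_nhds hA1))] with U h1 h2 h3 h4 h5
    refine ⟨h2.1, ?_, h3.le, by linarith, hhpos U h1, h5.le⟩
    exact (differentiableAt_of_deriv_ne_zero (by exact h3.ne)).hasDerivAt

/-- Lower barrier property. -/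
lemma barrier {m α γ c θ M : ℝ} {h : ℝ → ℝ} (hm : 0 < m) (hα : 1 < α) (hγ : 0 < γ)
    (hθ0 : 0 < θ) (hθ1 : θ < 1)
    (h0 : Tendsto h (𝓝[<] 1) (𝓝 0))
    (hE : ∀ᶠ U in 𝓝[<] (1:ℝ), 0 < U ∧ HasDerivAt h (deriv h U) U ∧ deriv h U ≤ 0 ∧
      -M ≤ deriv h U ∧ 0 < h U ∧ m / 2 ≤ m * U ^ (m - 1)) :
    ∀ᶠ U in 𝓝[<] (1:ℝ), ∀ y, 0 < y → y ≤ θ * (h U / γ) →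
      trajRHS m α γ c h U y ≤ θ * (deriv h U / γ) := by
  have hg : Tendsto (fun U => h U / γ) (𝓝[<] 1) (𝓝[>] 0) := by
    refine tendsto_nhdsWithin_iff.2 ⟨by simpa using h0.div_const γ, ?_⟩
    filter_upwards [hE] with U hU
    exact div_pos hU.2.2.2.2.1 hγ
  have hgp : Tendsto (fun U => (h U / γ) ^ (1 - α)) (𝓝[<] 1) atTop :=
    (tendsto_rpow_neg_nhdsGT_zero (by linarith)).comp hg
  have hgp2 := hgp.const_mul_atTop (show 0 < m / 2 * ((1 - θ) * γ) by
    have : 0 < 1 - θ := by linarith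
    positivity)
  filter_upwards [hE, hgp2.eventually_ge_atTop (c + θ * (M / γ))] with U hU hbig y hy hyle
  obtain ⟨hU0, -, -, hM, hH, hA⟩ := hU
  refine (rhs_le hm hU0 (by linarith) hγ hy hθ1 hH hyle).trans ?_
  have h1 : 0 ≤ (1 - θ) * γ * (h U / γ) ^ (1 - α) :=
    mul_nonneg (mul_nonneg (by linarith) hγ.le) (Real.rpow_nonneg (div_pos hH hγ).le _)
  have h2 := mul_le_mul_of_nonneg_right hA h1
  have h3 : θ * (-M / γ) ≤ θ * (deriv h U / γ) :=
    mul_le_mul_of_nonneg_left (div_le_div_of_nonneg_right hM hγ.le) hθ0.le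
  have h4 : θ * (-M / γ) = - (θ * (M / γ)) := by ring
  nlinarith

lemma exists_left {P : ℝ → Prop} (hP : ∀ᶠ U in 𝓝[<] (1:ℝ), P U) (x : ℝ) (hx : x < 1) :
    ∃ u ∈ Ioo x 1, ∀ U ∈ Ico u 1, P U := by
  obtain ⟨l, hl, hl2⟩ := (mem_nhdsLT_iff_exists_Ioo_subset' hx).1 hP
  have hl1 : l < 1 := hl
  refine ⟨(max l x + 1) / 2, ⟨?_, ?_⟩, fun U hU => hl2 ⟨?_, hU.2⟩⟩
  · have := le_max_right l x; linarith
  · have := max_lt hl1 hx; linarith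
  · have := le_max_left l x
    have := max_lt hl1 hx
    linarith [hU.1]

/-- Any solution tending to zero lies below `h / γ`. -/
lemma sol_le {m α γ c M : ℝ} {h φ : ℝ → ℝ} {a₁ : ℝ} (hm : 0 < m) (hγ : 0 < γ) (hc : 0 < c)
    (ha : a₁ < 1)
    (h0 : Tendsto h (𝓝[<] 1) (𝓝 0))
    (hE : ∀ᶠ U in 𝓝[<] (1:ℝ), 0 < U ∧ HasDerivAt h (deriv h U) U ∧ deriv h U ≤ 0 ∧
      -M ≤ deriv h U ∧ 0 < h U ∧ m / 2 ≤ m * U ^ (m - 1))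
    (hpos : ∀ U ∈ Ioo a₁ (1 : ℝ), 0 < φ U)
    (hd : ∀ U ∈ Ioo a₁ (1 : ℝ), HasDerivAt φ (trajRHS m α γ c h U (φ U)) U)
    (hl : Tendsto φ (𝓝[<] 1) (𝓝 0)) :
    ∀ᶠ U in 𝓝[<] (1:ℝ), φ U ≤ h U / γ := by
  obtain ⟨u, hu, hP⟩ := exists_left hE a₁ ha
  have key := fence_sing (D := fun t => φ t - h t / γ)
    (D' := fun t => trajRHS m α γ c h t (φ t) - deriv h t / γ) (a := u)
    (fun t ht => (hd t ⟨hu.1.trans ht.1, ht.2⟩).sub ((hP t ⟨ht.1.le, ht.2⟩).2.1.div_const γ))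
    (fun t ht hp => by
      obtain ⟨h1, h2, h3, h4, h5, h6⟩ := hP t ⟨ht.1.le, ht.2⟩
      have := rhs_ge_c (m := m) (α := α) (c := c) hm h1 hγ (hpos t ⟨hu.1.trans ht.1, ht.2⟩)
        (show h t / γ ≤ φ t by linarith)
      have h7 : deriv h t / γ ≤ 0 := div_nonpos_of_nonpos_of_nonneg h3 hγ.le
      show 0 ≤ trajRHS m α γ c h t (φ t) - deriv h t / γ
      linarith)
    (by simpa using hl.sub (h0.div_const γ))
  filter_upwards [Ioo_mem_nhdsLT hu.2] with U hU
  have := key U hU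
  linarith

lemma sol_ge {m α γ c M θ : ℝ} {h φ : ℝ → ℝ} {a₁ : ℝ} (hm : 0 < m) (hα : 1 < α) (hγ : 0 < γ)
    (hθ0 : 0 < θ) (hθ1 : θ < 1) (ha : a₁ < 1)
    (h0 : Tendsto h (𝓝[<] 1) (𝓝 0))
    (hE : ∀ᶠ U in 𝓝[<] (1:ℝ), 0 < U ∧ HasDerivAt h (deriv h U) U ∧ deriv h U ≤ 0 ∧
      -M ≤ deriv h U ∧ 0 < h U ∧ m / 2 ≤ m * U ^ (m - 1))
    (hpos : ∀ U ∈ Ioo a₁ (1 : ℝ), 0 < φ U)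
    (hd : ∀ U ∈ Ioo a₁ (1 : ℝ), HasDerivAt φ (trajRHS m α γ c h U (φ U)) U)
    (hl : Tendsto φ (𝓝[<] 1) (𝓝 0)) :
    ∀ᶠ U in 𝓝[<] (1:ℝ), θ * (h U / γ) ≤ φ U := by
  obtain ⟨u, hu, hP⟩ := exists_left (hE.and (barrier (c := c) hm hα hγ hθ0 hθ1 h0 hE)) a₁ ha
  have key := fence_sing (D := fun t => θ * (h t / γ) - φ t)
    (D' := fun t => θ * (deriv h t / γ) - trajRHS m α γ c h t (φ t)) (a := u)
    (fun t ht => (((hP t ⟨ht.1.le, ht.2⟩).1.2.1.div_const γ).const_mul θ).sub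
      (hd t ⟨hu.1.trans ht.1, ht.2⟩))
    (fun t ht hp => by
      have := (hP t ⟨ht.1.le, ht.2⟩).2 (φ t) (hpos t ⟨hu.1.trans ht.1, ht.2⟩) (by linarith)
      show 0 ≤ θ * (deriv h t / γ) - trajRHS m α γ c h t (φ t)
      linarith)
    (by simpa using ((h0.div_const γ).const_mul θ).sub hl)
  filter_upwards [Ioo_mem_nhdsLT hu.2] with U hU
  have := key U hU
  linarith

lemma uniq_le {m α γ c M : ℝ} {h φ₁ φ₂ : ℝ → ℝ} {a₁ a₂ : ℝ} (hm : 0 < m) (hα : 1 < α)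
    (hγ : 0 < γ) (hc : 0 < c) (ha₁ : a₁ < 1) (ha₂ : a₂ < 1)
    (h0 : Tendsto h (𝓝[<] 1) (𝓝 0))
    (hE : ∀ᶠ U in 𝓝[<] (1:ℝ), 0 < U ∧ HasDerivAt h (deriv h U) U ∧ deriv h U ≤ 0 ∧
      -M ≤ deriv h U ∧ 0 < h U ∧ m / 2 ≤ m * U ^ (m - 1))
    (hpos₁ : ∀ U ∈ Ioo a₁ (1 : ℝ), 0 < φ₁ U)
    (hd₁ : ∀ U ∈ Ioo a₁ (1 : ℝ), HasDerivAt φ₁ (trajRHS m α γ c h U (φ₁ U)) U)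
    (hl₁ : Tendsto φ₁ (𝓝[<] 1) (𝓝 0))
    (hpos₂ : ∀ U ∈ Ioo a₂ (1 : ℝ), 0 < φ₂ U)
    (hd₂ : ∀ U ∈ Ioo a₂ (1 : ℝ), HasDerivAt φ₂ (trajRHS m α γ c h U (φ₂ U)) U)
    (hl₂ : Tendsto φ₂ (𝓝[<] 1) (𝓝 0)) :
    ∀ᶠ U in 𝓝[<] (1:ℝ), φ₁ U ≤ φ₂ U := by
  obtain ⟨u, hu, hP⟩ := exists_left (hE.and (sol_le hm hγ hc ha₁ h0 hE hpos₁ hd₁ hl₁))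
    (max a₁ a₂) (max_lt ha₁ ha₂)
  have hu1 : a₁ < u := (le_max_left _ _).trans_lt hu.1
  have hu2 : a₂ < u := (le_max_right _ _).trans_lt hu.1
  have key := fence_sing (D := fun t => φ₁ t - φ₂ t)
    (D' := fun t => trajRHS m α γ c h t (φ₁ t) - trajRHS m α γ c h t (φ₂ t)) (a := u)
    (fun t ht => (hd₁ t ⟨hu1.trans ht.1, ht.2⟩).sub (hd₂ t ⟨hu2.trans ht.1, ht.2⟩))
    (fun t ht hp => by
      obtain ⟨h1, h2⟩ := hP t ⟨ht.1.le, ht.2⟩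
      have := rhs_mono (m := m) (α := α) (c := c) hm h1.1 (by linarith) hγ
        (hpos₂ t ⟨hu2.trans ht.1, ht.2⟩) (show φ₂ t ≤ φ₁ t by linarith) h2
      show 0 ≤ trajRHS m α γ c h t (φ₁ t) - trajRHS m α γ c h t (φ₂ t)
      linarith)
    (by simpa using hl₁.sub hl₂)
  filter_upwards [Ioo_mem_nhdsLT hu.2] with U hU
  have := key U hU
  linarith

lemma sol_asymp {m α γ c M k : ℝ} {h φ : ℝ → ℝ} {a₁ : ℝ} (hm : 0 < m) (hα : 1 < α) (hγ : 0 < γ)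
    (hc : 0 < c) (ha : a₁ < 1)
    (h0 : Tendsto h (𝓝[<] 1) (𝓝 0))
    (hk : Tendsto (fun U => h U / (1 - U)) (𝓝[<] 1) (𝓝 k))
    (hE : ∀ᶠ U in 𝓝[<] (1:ℝ), 0 < U ∧ HasDerivAt h (deriv h U) U ∧ deriv h U ≤ 0 ∧
      -M ≤ deriv h U ∧ 0 < h U ∧ m / 2 ≤ m * U ^ (m - 1))
    (hpos : ∀ U ∈ Ioo a₁ (1 : ℝ), 0 < φ U)
    (hd : ∀ U ∈ Ioo a₁ (1 : ℝ), HasDerivAt φ (trajRHS m α γ c h U (φ U)) U)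
    (hl : Tendsto φ (𝓝[<] 1) (𝓝 0)) :
    Tendsto (fun U => φ U / (1 - U)) (𝓝[<] 1) (𝓝 (k / γ)) := by
  have hr : Tendsto (fun U => φ U / (h U / γ)) (𝓝[<] 1) (𝓝 1) := by
    rw [tendsto_order]
    constructor
    · intro θ hθ
      set θ' : ℝ := (max θ 0 + 1) / 2
      have hm1 : max θ 0 < 1 := max_lt hθ one_pos
      have hm0 : 0 ≤ max θ 0 := le_max_right _ _
      have hm2 : θ ≤ max θ 0 := le_max_left _ _
      have hθ'0 : 0 < θ' := by simp only [θ']; linarith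
      have hθ'1 : θ' < 1 := by simp only [θ']; linarith
      have hθ'2 : θ < θ' := by simp only [θ']; linarith
      filter_upwards [hE, sol_ge hm hα hγ hθ'0 hθ'1 ha h0 hE hpos hd hl] with U h1 h2
      have hg : 0 < h U / γ := div_pos h1.2.2.2.2.1 hγ
      exact hθ'2.trans_le ((le_div_iff₀ hg).2 h2)
    · intro θ hθ
      filter_upwards [hE, sol_le hm hγ hc ha h0 hE hpos hd hl] with U h1 h2
      have hg : 0 < h U / γ := div_pos h1.2.2.2.2.1 hγ
      exact ((div_le_one hg).2 h2).trans_lt hθ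
  have hp := hr.mul (hk.div_const γ)
  rw [one_mul] at hp
  refine hp.congr' ?_
  filter_upwards [hE, self_mem_nhdsWithin] with U h1 h2
  have h3 : h U ≠ 0 := h1.2.2.2.2.1.ne'
  have h4 : U < 1 := h2
  have h5 : 1 - U ≠ 0 := by linarith
  field_simp

lemma exist_conc {m α γ c M : ℝ} {h : ℝ → ℝ} (hm : 0 < m) (hα : 1 < α) (hγ : 0 < γ)
    (hc : 0 < c)
    (h0 : Tendsto h (𝓝[<] 1) (𝓝 0))
    (hE : ∀ᶠ U in 𝓝[<] (1:ℝ), 0 < U ∧ HasDerivAt h (deriv h U) U ∧ deriv h U ≤ 0 ∧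
      -M ≤ deriv h U ∧ 0 < h U ∧ m / 2 ≤ m * U ^ (m - 1)) :
    ∃ U₁ ∈ Ioo (0 : ℝ) 1, ∃ φ : ℝ → ℝ,
      (∀ U ∈ Ioo U₁ (1 : ℝ), 0 < φ U) ∧
      (∀ U ∈ Ioo U₁ (1 : ℝ), HasDerivAt φ (trajRHS m α γ c h U (φ U)) U) ∧
      Tendsto φ (𝓝[<] 1) (𝓝 0) := by
  obtain ⟨u, hu, hP⟩ := exists_left (hE.and (barrier (c := c) (θ := 1 / 2) hm hα hγ (by norm_num)
    (by norm_num) h0 hE)) 0 one_pos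
  set g : ℝ → ℝ := fun t => h t / γ with hg
  set ℓ : ℝ → ℝ := fun t => 1 / 2 * (h t / γ) with hℓ
  set C : ℝ → ℝ → ℝ := fun t y => max (ℓ t) (min y (g t)) with hC
  set F : ℝ → ℝ → ℝ := fun t y => trajRHS m α γ c h t (C t y) with hF
  have hgpos : ∀ t ∈ Ico u 1, 0 < g t := fun t ht => div_pos (hP t ht).1.2.2.2.2.1 hγ
  have hℓpos : ∀ t ∈ Ico u 1, 0 < ℓ t := fun t ht => mul_pos (by norm_num) (hgpos t ht)
  have hℓg : ∀ t ∈ Ico u 1, ℓ t ≤ g t := fun t ht => by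
    have := hgpos t ht
    simp only [hℓ]; simp only [hg] at this ⊢; linarith
  have hCl : ∀ t y, ℓ t ≤ C t y := fun t y => le_max_left _ _
  have hCg : ∀ t ∈ Ico u 1, ∀ y, C t y ≤ g t := fun t ht y => max_le (hℓg t ht) (min_le_right _ _)
  have hCid : ∀ t y, ℓ t ≤ y → y ≤ g t → C t y = y := fun t y h1 h2 => by
    simp only [hC]; rw [min_eq_left h2, max_eq_right h1]
  have hupos : ∀ t ∈ Ico u 1, 0 < t := fun t ht => (hP t ht).1.1
  have hhc : ContinuousOn h (Ico u 1) := fun t ht =>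
    (hP t ht).1.2.1.continuousAt.continuousWithinAt
  have hgc : ContinuousOn g (Ico u 1) := hhc.div_const γ
  have hℓc : ContinuousOn ℓ (Ico u 1) := continuousOn_const.mul hgc
  have hpw : ∀ r : ℝ, ContinuousOn (fun t : ℝ => t ^ r) (Ico u 1) := fun r =>
    continuousOn_id.rpow_const (fun t ht => Or.inl (hupos t ht).ne')
  have hFc : ∀ y, ContinuousOn (fun t => F t y) (Ico u 1) := by
    intro y
    have hCc : ContinuousOn (fun t => C t y) (Ico u 1) :=
      ContinuousOn.sup hℓc (ContinuousOn.inf continuousOn_const hgc)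
    have hne : ∀ t ∈ Ico u 1, C t y ≠ 0 := fun t ht => ((hℓpos t ht).trans_le (hCl t y)).ne'
    simp only [hF, trajRHS]
    refine (continuousOn_const.add ((continuousOn_const.mul (hpw _)).mul
      (hCc.rpow_const (fun t ht => Or.inl (hne t ht))))).sub
      (((continuousOn_const.mul (hpw _)).mul hhc).div
        (hCc.rpow_const (fun t ht => Or.inl (hne t ht))) (fun t ht => ?_))
    exact (Real.rpow_pos_of_pos ((hℓpos t ht).trans_le (hCl t y)) _).ne'
  have hFm : ∀ t ∈ Ico u 1, Monotone (F t) := by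
    intro t ht y z hyz
    exact rhs_mono hm (hupos t ht) (by linarith) hγ ((hℓpos t ht).trans_le (hCl t y))
      (max_le_max le_rfl (min_le_min hyz le_rfl)) (hCg t ht z)
  have hFg : ∀ t ∈ Ico u 1, c ≤ F t (g t) := by
    intro t ht
    simp only [hF]
    rw [hCid t _ (hℓg t ht) le_rfl]
    exact rhs_ge_c hm (hupos t ht) hγ (hgpos t ht) le_rfl
  have hFℓ : ∀ t ∈ Ico u 1, F t (ℓ t) ≤ 1 / 2 * (deriv h t / γ) := by
    intro t ht
    simp only [hF]
    rw [hCid t _ le_rfl (hℓg t ht)]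
    exact (hP t ht).2 _ (hℓpos t ht) le_rfl
  have hIcc : ∀ b ∈ Ioo u 1, Icc u b ⊆ Ico u 1 := fun b hb t ht => ⟨ht.1, ht.2.trans_lt hb.2⟩
  have hg0 : Tendsto g (𝓝[<] 1) (𝓝 0) := by simpa using h0.div_const γ
  have hLip : ∀ b ∈ Ioo u 1, ∃ K : NNReal, ∀ t ∈ Icc u b, ∀ y z,
      |F t y - F t z| ≤ K * |y - z| := by
    intro b hb
    have hne : (Icc u b).Nonempty := ⟨u, le_rfl, hb.1.le⟩
    obtain ⟨t0, ht0, hmin⟩ := isCompact_Icc.exists_isMinOn hne (hℓc.mono (hIcc b hb))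
    obtain ⟨B1, hB1⟩ := isCompact_Icc.exists_bound_of_continuousOn
      ((continuousOn_const (c := γ * m)).mul (hpw (m - 1)) |>.mono (hIcc b hb))
    obtain ⟨B2, hB2⟩ := isCompact_Icc.exists_bound_of_continuousOn
      (((continuousOn_const (c := m)).mul (hpw (m - 1))).mul hhc |>.mono (hIcc b hb))
    set δ := ℓ t0
    have hδ : 0 < δ := hℓpos t0 (hIcc b hb ht0)
    have hB10 : 0 ≤ B1 := (norm_nonneg _).trans (hB1 u ⟨le_rfl, hb.1.le⟩)
    have hB20 : 0 ≤ B2 := (norm_nonneg _).trans (hB2 u ⟨le_rfl, hb.1.le⟩)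
    set K1 := |1 - α| * δ ^ (1 - α - 1)
    set K2 := |-α| * δ ^ (-α - 1)
    have hK1 : 0 ≤ K1 := mul_nonneg (abs_nonneg _) (Real.rpow_nonneg hδ.le _)
    have hK2 : 0 ≤ K2 := mul_nonneg (abs_nonneg _) (Real.rpow_nonneg hδ.le _)
    refine ⟨⟨B1 * K1 + B2 * K2, by positivity⟩, fun t ht y z => ?_⟩
    have hδt : δ ≤ ℓ t := hmin ht
    have hy : δ ≤ C t y := hδt.trans (hCl t y)
    have hz : δ ≤ C t z := hδt.trans (hCl t z)
    have hCyz : |C t y - C t z| ≤ |y - z| := by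
      simp only [hC]
      refine (abs_max_sub_max_le_max _ _ _ _).trans ?_
      simp only [sub_self, abs_zero]
      refine max_le (abs_nonneg _) ((abs_min_sub_min_le_max _ _ _ _).trans ?_)
      simp
    have e1 := rpow_lip_s13 (r := 1 - α) (by linarith) hδ _ _ hy hz
    have e2 := rpow_lip_s13 (r := -α) (by linarith) hδ _ _ hy hz
    have b1 : |γ * m * t ^ (m - 1)| ≤ B1 := hB1 t ht
    have b2 : |m * t ^ (m - 1) * h t| ≤ B2 := hB2 t ht
    have hFe : F t y - F t z = (γ * m * t ^ (m - 1)) * (C t y ^ (1 - α) - C t z ^ (1 - α))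
        - (m * t ^ (m - 1) * h t) * (C t y ^ (-α) - C t z ^ (-α)) := by
      simp only [hF, trajRHS]
      rw [div_eq_mul_inv, div_eq_mul_inv, ← Real.rpow_neg (hδ.le.trans hy),
        ← Real.rpow_neg (hδ.le.trans hz)]
      ring
    rw [hFe]
    refine (abs_sub _ _).trans ?_
    rw [abs_mul (γ * m * t ^ (m - 1)), abs_mul (m * t ^ (m - 1) * h t)]
    have f1 := mul_le_mul b1 (e1.trans (mul_le_mul_of_nonneg_left hCyz hK1)) (abs_nonneg _) hB10
    have f2 := mul_le_mul b2 (e2.trans (mul_le_mul_of_nonneg_left hCyz hK2)) (abs_nonneg _) hB20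
    show _ ≤ (B1 * K1 + B2 * K2) * |y - z|
    calc _ ≤ B1 * (K1 * |y - z|) + B2 * (K2 * |y - z|) := add_le_add f1 f2
      _ = _ := by ring
  have hBd : ∀ b ∈ Ioo u 1, ∃ L : ℝ, ∀ t ∈ Icc u b, ∀ y, |F t y| ≤ L := by
    intro b hb
    have hFu : ∀ t ∈ Ico u 1, ∀ y, F t y = trajRHS m α γ c h t (C t y) := fun _ _ _ => rfl
    obtain ⟨B, hB⟩ := isCompact_Icc.exists_bound_of_continuousOn
      ((hFc 0).mono (hIcc b hb))
    obtain ⟨G, hG⟩ := isCompact_Icc.exists_bound_of_continuousOn (hgc.mono (hIcc b hb))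
    obtain ⟨B', hB'⟩ := isCompact_Icc.exists_bound_of_continuousOn
      ((hFc G).mono (hIcc b hb))
    refine ⟨max B B', fun t ht y => ?_⟩
    have ht' := hIcc b hb ht
    have h1 : F t 0 ≤ F t y := by
      have : C t 0 ≤ C t y := by
        simp only [hC]
        rw [min_eq_left (hgpos t ht').le, max_eq_left (hℓpos t ht').le]
        exact le_max_left _ _
      exact rhs_mono hm (hupos t ht') (by linarith) hγ ((hℓpos t ht').trans_le (hCl t 0))
        this (hCg t ht' y)
    have h2 : F t y ≤ F t G := by
      have hgG : g t ≤ G := (le_abs_self _).trans (hG t ht)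
      have : C t y ≤ C t G := by
        simp only [hC]
        exact max_le_max le_rfl (le_min ((min_le_right _ _).trans hgG) (min_le_right _ _))
      exact rhs_mono hm (hupos t ht') (by linarith) hγ ((hℓpos t ht').trans_le (hCl t y))
        this (hCg t ht' G)
    have h3 := abs_le.1 (hB t ht)
    have h4 := abs_le.1 (hB' t ht)
    rw [abs_le]
    have := le_max_left B B'
    have := le_max_right B B'
    constructor <;> linarith [h3.1, h4.2]
  obtain ⟨φ, hφ⟩ := exists_sol F u hu.2 ℓ g (fun t => 1 / 2 * (deriv h t / γ))
    (fun t => deriv h t / γ) hLip hFc hBd hFm (fun t ht => (hℓpos t ht).le) hℓg hg0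
    (fun t ht => (hP t ht).1.2.1.div_const γ)
    (fun t ht => ((hP t ht).1.2.1.div_const γ).const_mul _)
    (fun t ht => le_trans (div_nonpos_of_nonpos_of_nonneg (hP t ht).1.2.2.1 hγ.le)
      (hc.le.trans (hFg t ht))) hFℓ
  · refine ⟨u, hu, φ, fun t ht => ?_, fun t ht => ?_, ?_⟩
    · exact (hℓpos t ⟨ht.1.le, ht.2⟩).trans_le (hφ t ht).1
    · have := (hφ t ht).2.2
      simp only [hF] at this
      rwa [hCid t _ (hφ t ht).1 (hφ t ht).2.1] at this
    · refine tendsto_of_tendsto_of_tendsto_of_le_of_le' tendsto_const_nhds hg0 ?_ ?_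
      · filter_upwards [Ioo_mem_nhdsLT hu.2] with t ht
        exact ((hℓpos t ⟨ht.1.le, ht.2⟩).trans_le (hφ t ht).1).le
      · filter_upwards [Ioo_mem_nhdsLT hu.2] with t ht
        exact (hφ t ht).2.1

/-- Behaviour near `U = 1` of the trajectory through `(1,0)` when `1 < p < 2` and
`γ > 0`: there is a solution of the trajectory equation on a left neighbourhood of `1`
tending to `0` at `1⁻`, with `φ(U)/(1-U) → |h'(1)|/γ`, and any two such solutions
coincide on a left neighbourhood of `1`. -/
theorem statement13 (m p a α γ c : ℝ) (h : ℝ → ℝ)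
    (hm : 0 < m) (hp : 1 < p) (hmp : 1 < m * (p - 1)) (hα : α = 1 / (p - 1))
    (hp2 : p < 2)
    (ha0 : 0 ≤ a) (ha1 : a < 1)
    (hhC1 : ContDiffOn ℝ 1 h (Ici 0))
    (hh0 : h 0 = 0)
    (hhneg : ∀ u ∈ Icc (0 : ℝ) a, h u ≤ 0)
    (hhpos : ∀ u ∈ Ioo a (1 : ℝ), 0 < h u)
    (hhgt : ∀ u : ℝ, 1 < u → h u < 0)
    (hh1 : deriv h 1 < 0)
    (hγ : 0 < γ) (hc : 0 < c) :
    (∃ U₁ ∈ Ioo (0 : ℝ) 1, ∃ φ : ℝ → ℝ,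
      (∀ U ∈ Ioo U₁ (1 : ℝ), 0 < φ U) ∧
      (∀ U ∈ Ioo U₁ (1 : ℝ), HasDerivAt φ (trajRHS m α γ c h U (φ U)) U) ∧
      Tendsto φ (nhdsWithin 1 (Iio 1)) (nhds 0) ∧
      Tendsto (fun U => φ U / (1 - U)) (nhdsWithin 1 (Iio 1))
        (nhds (|deriv h 1| / γ))) ∧
    (∀ (φ₁ φ₂ : ℝ → ℝ) (a₁ a₂ : ℝ), a₁ ∈ Ioo (0 : ℝ) 1 → a₂ ∈ Ioo (0 : ℝ) 1 →
      (∀ U ∈ Ioo a₁ (1 : ℝ), 0 < φ₁ U) →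
      (∀ U ∈ Ioo a₁ (1 : ℝ), HasDerivAt φ₁ (trajRHS m α γ c h U (φ₁ U)) U) →
      Tendsto φ₁ (nhdsWithin 1 (Iio 1)) (nhds 0) →
      (∀ U ∈ Ioo a₂ (1 : ℝ), 0 < φ₂ U) →
      (∀ U ∈ Ioo a₂ (1 : ℝ), HasDerivAt φ₂ (trajRHS m α γ c h U (φ₂ U)) U) →
      Tendsto φ₂ (nhdsWithin 1 (Iio 1)) (nhds 0) →
      ∃ b ∈ Ioo (0 : ℝ) 1, ∀ U ∈ Ioo b (1 : ℝ), φ₁ U = φ₂ U) := by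
  have hα1 : 1 < α := by
    rw [hα, lt_div_iff₀ (by linarith)]; linarith
  obtain ⟨h10, h0, hk, M, hE⟩ := setup m a h hm ha1 hhC1 hhpos hhgt hh1
  refine ⟨?_, ?_⟩
  · obtain ⟨u, hu, φ, h1, h2, h3⟩ := exist_conc (c := c) hm hα1 hγ hc h0 hE
    exact ⟨u, hu, φ, h1, h2, h3, sol_asymp hm hα1 hγ hc hu.2 h0 hk hE h1 h2 h3⟩
  · intro φ₁ φ₂ a₁ a₂ ha₁ ha₂ p1 d1 l1 p2 d2 l2
    have e1 := uniq_le hm hα1 hγ hc ha₁.2 ha₂.2 h0 hE p1 d1 l1 p2 d2 l2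
    have e2 := uniq_le hm hα1 hγ hc ha₂.2 ha₁.2 h0 hE p2 d2 l2 p1 d1 l1
    obtain ⟨b, hb, hP⟩ := exists_left (e1.and e2) 0 one_pos
    exact ⟨b, hb, fun U hU => le_antisymm (hP U ⟨hU.1.le, hU.2⟩).1 (hP U ⟨hU.1.le, hU.2⟩).2⟩
end

section
/- Under the stated assumptions on the ODE system: (a) lim_{t→∞} f(t) = 1; (b) if f₀ ∈ (1−δ,1), then f is strictly monotone increasing and t ↦ g(t) − c* t is strictly monotone decreasing; (c) if f₀ ∈ (1,1+δ), then f is strictly monotone decreasing and t ↦ g(t) − c* t is strictly monotone increasing. -/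
open Set Filter Topology

/-- Properties (a)-(c) of solutions `(f,g)` of the ODE system
`f' = φ(f)`, `g' = c* f^{(p-1)m-1} - k φ(f)/f` on `[0,∞)`:
(a) `f(t) → 1`; (b) if `f₀ ∈ (1-δ,1)` then `f` is strictly increasing and
`g(t) - c* t` strictly decreasing; (c) if `f₀ ∈ (1,1+δ)` then `f` is strictly
decreasing and `g(t) - c* t` strictly increasing. -/
theorem statement14 (m p cstar k δ f₀ : ℝ) (φ f g : ℝ → ℝ)
    (hm : 0 < m) (hp : 1 < p) (hmp : 1 < m * (p - 1))
    (hcstar : 0 < cstar) (hk : 0 < k) (hδ0 : 0 < δ) (hδ1 : δ < 1)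
    (hφC1 : ContDiffOn ℝ 1 φ (Icc (1 - δ) (1 + δ)))
    (hφ1 : φ 1 = 0)
    (hφ'1 : derivWithin φ (Icc (1 - δ) (1 + δ)) 1 < 0)
    (hφpos : ∀ u ∈ Ico (1 - δ) (1 : ℝ), 0 < φ u)
    (hφneg : ∀ u ∈ Ioc (1 : ℝ) (1 + δ), φ u < 0)
    (hf0 : f 0 = f₀) (hf₀ : f₀ ∈ Ioo (1 - δ) (1 + δ))
    (hfmem : ∀ t : ℝ, 0 ≤ t → f t ∈ Icc (1 - δ) (1 + δ))
    (hfode : ∀ t : ℝ, 0 ≤ t → HasDerivWithinAt f (φ (f t)) (Ici 0) t)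
    (hgode : ∀ t : ℝ, 0 ≤ t →
      HasDerivWithinAt g (cstar * f t ^ ((p - 1) * m - 1) - k * φ (f t) / f t)
        (Ici 0) t) :
    Tendsto f atTop (nhds 1) ∧
    (f₀ ∈ Ioo (1 - δ) (1 : ℝ) →
      StrictMonoOn f (Ici 0) ∧ StrictAntiOn (fun t => g t - cstar * t) (Ici 0)) ∧
    (f₀ ∈ Ioo (1 : ℝ) (1 + δ) →
      StrictAntiOn f (Ici 0) ∧ StrictMonoOn (fun t => g t - cstar * t) (Ici 0)) := by
  have hint : interior (Ici (0:ℝ)) = Ioi 0 := interior_Ici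
  have hconv : Convex ℝ (Ici (0:ℝ)) := convex_Ici 0
  have hfc : ContinuousOn f (Ici 0) := fun t ht => (hfode t ht).continuousWithinAt
  have hgc : ContinuousOn g (Ici 0) := fun t ht => (hgode t ht).continuousWithinAt
  have hφc : ContinuousOn φ (Icc (1 - δ) (1 + δ)) := hφC1.continuousOn
  -- sign of the Lyapunov derivative
  have hsgn : ∀ u ∈ Icc (1 - δ) (1 + δ), u ≠ 1 → (u - 1) * φ u < 0 := by
    intro u hu hne
    rcases lt_or_gt_of_ne hne with h | h
    · exact mul_neg_of_neg_of_pos (by linarith) (hφpos u ⟨hu.1, h⟩)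
    · exact mul_neg_of_pos_of_neg (by linarith) (hφneg u ⟨h, hu.2⟩)
  have hsgn' : ∀ u ∈ Icc (1 - δ) (1 + δ), (u - 1) * φ u ≤ 0 := by
    intro u hu
    by_cases h : u = 1
    · simp [h]
    · exact (hsgn u hu h).le
  have hWd : ∀ c : ℝ, ∀ t ∈ Ici (0:ℝ), HasDerivWithinAt (fun t => (f t - 1) ^ 2 + c * t)
      (2 * ((f t - 1) * φ (f t)) + c) (Ici 0) t := by
    intro c t ht
    have h1 := ((hfode t ht).sub_const 1).pow 2
    have h2 := ((hasDerivAt_id t).const_mul c).hasDerivWithinAt (s := Ici 0)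
    refine (h1.add h2).congr_deriv ?_
    simp
    ring
  have hWanti : ∀ c : ℝ, (∀ t, 0 ≤ t → 2 * ((f t - 1) * φ (f t)) + c ≤ 0) →
      AntitoneOn (fun t => (f t - 1) ^ 2 + c * t) (Ici 0) := by
    intro c hc
    refine antitoneOn_of_hasDerivWithinAt_nonpos hconv
      (f' := fun t => 2 * ((f t - 1) * φ (f t)) + c)
      (fun t ht => (hWd c t ht).continuousWithinAt)
      (fun t ht => (hWd c t (interior_subset ht)).mono interior_subset)
      (fun t ht => hc t (interior_subset ht))
  have hV : AntitoneOn (fun t => (f t - 1) ^ 2 + 0 * t) (Ici 0) :=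
    hWanti 0 (fun t ht => by linarith [hsgn' _ (hfmem t ht)])
  have hex : ∀ ε > 0, ∃ T, 0 ≤ T ∧ |f T - 1| < ε := by
    intro ε hε
    by_contra! hcon
    have hKc : IsCompact (Icc (1 - δ) (1 + δ) ∩ {u : ℝ | ε ≤ |u - 1|}) :=
      isCompact_Icc.inter_right (isClosed_le continuous_const (by fun_prop))
    have hcont : ContinuousOn (fun u => (u - 1) * φ u)
        (Icc (1 - δ) (1 + δ) ∩ {u : ℝ | ε ≤ |u - 1|}) :=
      (ContinuousOn.mul (by fun_prop) hφc).mono inter_subset_left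
    obtain ⟨u, hu, hmax⟩ := hKc.exists_isMaxOn
      ⟨f 0, hfmem 0 le_rfl, hcon 0 le_rfl⟩ hcont
    have hune : u ≠ 1 := by
      rintro rfl
      have := hu.2
      simp at this
      linarith
    have hneg := hsgn u hu.1 hune
    set c := -((u - 1) * φ u) with hc
    have hcpos : 0 < c := by linarith
    have hA := hWanti c (fun t ht => by
      have h1 : (f t - 1) * φ (f t) ≤ (u - 1) * φ u := hmax ⟨hfmem t ht, hcon t ht⟩
      linarith)
    have hT0 : 0 ≤ ((f 0 - 1) ^ 2 + 1) / c := by positivity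
    have h2 := hA (mem_Ici.2 le_rfl) (mem_Ici.2 hT0) hT0
    simp only [mul_zero] at h2
    rw [mul_div_cancel₀ _ hcpos.ne'] at h2
    nlinarith [sq_nonneg (f (((f 0 - 1) ^ 2 + 1) / c) - 1)]
  have hlim : Tendsto f atTop (nhds 1) := by
    rw [Metric.tendsto_atTop]
    intro ε hε
    obtain ⟨T, hT, hTε⟩ := hex ε hε
    refine ⟨T, fun t ht => ?_⟩
    have h := hV (mem_Ici.2 hT) (mem_Ici.2 (hT.trans ht)) ht
    simp only [zero_mul, add_zero] at h
    rw [Real.dist_eq]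
    exact (sq_le_sq.1 h).trans_lt hTε
  -- uniqueness: the equilibrium is not reached in finite time
  obtain ⟨K, hK⟩ := hφC1.exists_lipschitzOnWith one_ne_zero (convex_Icc _ _) isCompact_Icc
  have hne : f₀ ≠ 1 → ∀ t, 0 ≤ t → f t ≠ 1 := by
    intro h0 T hT hfT
    have hIcc : Icc 0 T ⊆ Ici (0:ℝ) := fun t ht => ht.1
    have hE : EqOn f (fun _ => (1:ℝ)) (Icc 0 T) := by
      refine ODE_solution_unique_of_mem_Icc_left (v := fun _ => φ)
        (s := fun _ => Icc (1 - δ) (1 + δ)) (K := K) (fun _ _ => hK) (hfc.mono hIcc) ?_ ?_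
        continuousOn_const ?_ ?_ hfT
      · intro t ht
        exact ((hfode t ht.1.le).hasDerivAt (Ici_mem_nhds ht.1)).hasDerivWithinAt
      · intro t ht
        exact hfmem t ht.1.le
      · intro t ht
        simp only [hφ1]
        exact hasDerivWithinAt_const _ _ _
      · intro t ht
        constructor <;> linarith
    exact h0 (hf0 ▸ hE ⟨le_rfl, hT⟩)
  have he : 0 < (p - 1) * m - 1 := by linarith [mul_comm m (p - 1)]
  have hGd : ∀ t ∈ Ici (0:ℝ), HasDerivWithinAt (fun t => g t - cstar * t)
      (cstar * f t ^ ((p - 1) * m - 1) - k * φ (f t) / f t - cstar) (Ici 0) t := by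
    intro t ht
    have h2 := ((hasDerivAt_id t).const_mul cstar).hasDerivWithinAt (s := Ici 0)
    refine ((hgode t ht).sub h2).congr_deriv ?_
    simp
  have hGc : ContinuousOn (fun t => g t - cstar * t) (Ici 0) :=
    fun t ht => (hGd t ht).continuousWithinAt
  refine ⟨hlim, fun h0 => ?_, fun h0 => ?_⟩
  · have hlt : ∀ t, 0 ≤ t → f t < 1 := by
      intro t ht
      by_contra! hge
      have hIcc : Icc 0 t ⊆ Ici (0:ℝ) := fun t ht => ht.1
      obtain ⟨s, hs, hs1⟩ := intermediate_value_Icc ht (hfc.mono hIcc)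
        (show (1:ℝ) ∈ Icc (f 0) (f t) from ⟨by rw [hf0]; exact h0.2.le, hge⟩)
      exact hne h0.2.ne s hs.1 hs1
    constructor
    · exact strictMonoOn_of_hasDerivWithinAt_pos hconv hfc (f' := fun t => φ (f t))
        (fun t ht => (hfode t (interior_subset ht)).mono interior_subset)
        (fun t ht => hφpos _ ⟨(hfmem t (interior_subset ht)).1, hlt t (interior_subset ht)⟩)
    · refine strictAntiOn_of_hasDerivWithinAt_neg hconv hGc
        (fun t ht => (hGd t (interior_subset ht)).mono interior_subset) (fun t ht => ?_)
      have ht0 : 0 ≤ t := interior_subset ht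
      have hm1 := hfmem t ht0
      have hpos : 0 < f t := by linarith [hm1.1]
      have h1 : f t ^ ((p - 1) * m - 1) < 1 := Real.rpow_lt_one hpos.le (hlt t ht0) he
      have h2 : 0 < k * φ (f t) / f t :=
        div_pos (mul_pos hk (hφpos _ ⟨hm1.1, hlt t ht0⟩)) hpos
      nlinarith
  · have hgt : ∀ t, 0 ≤ t → 1 < f t := by
      intro t ht
      by_contra! hge
      have hIcc : Icc 0 t ⊆ Ici (0:ℝ) := fun t ht => ht.1
      obtain ⟨s, hs, hs1⟩ := intermediate_value_Icc' ht (hfc.mono hIcc)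
        (show (1:ℝ) ∈ Icc (f t) (f 0) from ⟨hge, by rw [hf0]; exact h0.1.le⟩)
      exact hne h0.1.ne' s hs.1 hs1
    constructor
    · exact strictAntiOn_of_hasDerivWithinAt_neg hconv hfc (f' := fun t => φ (f t))
        (fun t ht => (hfode t (interior_subset ht)).mono interior_subset)
        (fun t ht => hφneg _ ⟨hgt t (interior_subset ht), (hfmem t (interior_subset ht)).2⟩)
    · refine strictMonoOn_of_hasDerivWithinAt_pos hconv hGc
        (fun t ht => (hGd t (interior_subset ht)).mono interior_subset) (fun t ht => ?_)
      have ht0 : 0 ≤ t := interior_subset ht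
      have hm1 := hfmem t ht0
      have hpos : 0 < f t := by linarith [hm1.1]
      have h1 : 1 < f t ^ ((p - 1) * m - 1) := Real.one_lt_rpow (hgt t ht0) he
      have h2 : k * φ (f t) / f t < 0 :=
        div_neg_of_neg_of_pos (mul_neg_of_pos_of_neg hk (hφneg _ ⟨hgt t ht0, hm1.2⟩)) hpos
      nlinarith
end

section
/- Under the stated assumptions on the ODE system: (d) lim_{t→∞} g(t) = ∞; and (e) lim_{t→∞} g'(t) = c*. -/
open Set Filter Topology

lemma growth_aux (h h' : ℝ → ℝ) (C T : ℝ) (hd : ∀ t, T ≤ t → HasDerivAt h (h' t) t)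
    (hC : ∀ t, T ≤ t → C ≤ h' t) (s t : ℝ) (hs : T ≤ s) (hst : s ≤ t) :
    C * (t - s) ≤ h t - h s := by
  refine Convex.mul_sub_le_image_sub_of_le_deriv (convex_Ici T) ?_ ?_ ?_ s hs t (hs.trans hst) hst
  · intro x hx
    exact (hd x hx).continuousAt.continuousWithinAt
  · intro x hx
    exact (hd x (interior_subset hx)).differentiableAt.differentiableWithinAt
  · intro x hx
    rw [(hd x (interior_subset hx)).deriv]
    exact hC x (interior_subset hx)

lemma f_tendsto_aux (δ : ℝ) (φ f : ℝ → ℝ)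
    (hc : ContinuousOn φ (Icc (1 - δ) (1 + δ))) (hφ1 : φ 1 = 0)
    (hφpos : ∀ u ∈ Ico (1 - δ) (1 : ℝ), 0 < φ u)
    (hφneg : ∀ u ∈ Ioc (1 : ℝ) (1 + δ), φ u < 0)
    (hfmem : ∀ t : ℝ, 1 ≤ t → f t ∈ Icc (1 - δ) (1 + δ))
    (hd : ∀ t : ℝ, 1 ≤ t → HasDerivAt f (φ (f t)) t) :
    Tendsto f atTop (𝓝 1) := by
  have hneg : ∀ u ∈ Icc (1 - δ) (1 + δ), u ≠ 1 → (u - 1) * φ u < 0 := by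
    intro u hu h1
    rcases lt_or_gt_of_ne h1 with h | h
    · exact mul_neg_of_neg_of_pos (by linarith) (hφpos u ⟨hu.1, h⟩)
    · exact mul_neg_of_pos_of_neg (by linarith) (hφneg u ⟨h, hu.2⟩)
  have hnp : ∀ u ∈ Icc (1 - δ) (1 + δ), (u - 1) * φ u ≤ 0 := by
    intro u hu
    by_cases h : u = 1
    · simp [h]
    · exact (hneg u hu h).le
  have hV : ∀ t, 1 ≤ t →
      HasDerivAt (fun t => -(f t - 1) ^ 2) (-(2 * ((f t - 1) * φ (f t)))) t := by
    intro t ht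
    have := (((hd t ht).sub_const 1).pow 2).neg
    refine HasDerivAt.congr_deriv this ?_
    norm_num
    ring
  have hmono := growth_aux _ _ 0 1 hV (fun t ht => by
    have := hnp _ (hfmem t ht)
    linarith)
  rw [Metric.tendsto_atTop]
  intro ε hε
  have hex : ∃ T, 1 ≤ T ∧ (f T - 1) ^ 2 < ε ^ 2 := by
    by_contra! hcon
    have hK : IsCompact (Icc (1 - δ) (1 + δ) ∩ {u : ℝ | ε ^ 2 ≤ (u - 1) ^ 2}) :=
      isCompact_Icc.inter_right (isClosed_le (by fun_prop) (by fun_prop))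
    obtain ⟨u, hu, hmax⟩ := hK.exists_isMaxOn ⟨f 1, hfmem 1 le_rfl, hcon 1 le_rfl⟩
      (f := fun u => (u - 1) * φ u)
      ((by fun_prop : ContinuousOn (fun u : ℝ => u - 1) _).mul (hc.mono inter_subset_left))
    have hu1 : u ≠ 1 := by
      rintro rfl
      have h2 : ε ^ 2 ≤ ((1 : ℝ) - 1) ^ 2 := hu.2
      have : 0 < ε ^ 2 := by positivity
      norm_num at h2
      linarith
    have hη := hneg u hu.1 hu1
    set η := (u - 1) * φ u with hηdef
    have hg := growth_aux _ _ (-2 * η) 1 hV (fun t ht => by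
      have : (f t - 1) * φ (f t) ≤ η := hmax ⟨hfmem t ht, hcon t ht⟩
      linarith)
    have hpos : 0 ≤ (f 1 - 1) ^ 2 / (-2 * η) := div_nonneg (sq_nonneg _) (by linarith)
    have h3 := hg 1 (2 + (f 1 - 1) ^ 2 / (-2 * η)) le_rfl (by linarith)
    have h4 : (-2 * η) * (2 + (f 1 - 1) ^ 2 / (-2 * η) - 1) = -2 * η + (f 1 - 1) ^ 2 := by
      have : (-2 * η) ≠ 0 := by linarith
      rw [show (-2 * η) * (2 + (f 1 - 1) ^ 2 / (-2 * η) - 1)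
        = -2 * η + (-2 * η) * ((f 1 - 1) ^ 2 / (-2 * η)) by ring, mul_div_cancel₀ _ this]
    rw [h4] at h3
    have := sq_nonneg (f (2 + (f 1 - 1) ^ 2 / (-2 * η)) - 1)
    linarith
  obtain ⟨T, hT, hTε⟩ := hex
  refine ⟨T, fun t ht => ?_⟩
  have := hmono T t hT ht
  rw [Real.dist_eq]
  exact abs_lt_of_sq_lt_sq (by linarith) hε.le

/-- Properties (d)-(e) of solutions `(f,g)` of the ODE system
`f' = φ(f)`, `g' = c* f^{(p-1)m-1} - k φ(f)/f` on `[0,∞)`: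
(d) `g(t) → ∞`; (e) `g'(t) → c*` as `t → ∞`. -/
theorem statement15 (m p cstar k δ f₀ : ℝ) (φ f g : ℝ → ℝ)
    (hm : 0 < m) (hp : 1 < p) (hmp : 1 < m * (p - 1))
    (hcstar : 0 < cstar) (hk : 0 < k) (hδ0 : 0 < δ) (hδ1 : δ < 1)
    (hφC1 : ContDiffOn ℝ 1 φ (Icc (1 - δ) (1 + δ)))
    (hφ1 : φ 1 = 0)
    (hφ'1 : derivWithin φ (Icc (1 - δ) (1 + δ)) 1 < 0)
    (hφpos : ∀ u ∈ Ico (1 - δ) (1 : ℝ), 0 < φ u)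
    (hφneg : ∀ u ∈ Ioc (1 : ℝ) (1 + δ), φ u < 0)
    (hf0 : f 0 = f₀) (hf₀ : f₀ ∈ Ioo (1 - δ) (1 + δ))
    (hfmem : ∀ t : ℝ, 0 ≤ t → f t ∈ Icc (1 - δ) (1 + δ))
    (hfode : ∀ t : ℝ, 0 ≤ t → HasDerivWithinAt f (φ (f t)) (Ici 0) t)
    (hgode : ∀ t : ℝ, 0 ≤ t →
      HasDerivWithinAt g (cstar * f t ^ ((p - 1) * m - 1) - k * φ (f t) / f t)
        (Ici 0) t) :
    Tendsto g atTop atTop ∧ Tendsto (deriv g) atTop (nhds cstar) := by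
  have hf1 : ∀ t : ℝ, 1 ≤ t → HasDerivAt f (φ (f t)) t := fun t ht =>
    (hfode t (by linarith)).hasDerivAt (Ici_mem_nhds (by linarith))
  have hg1 : ∀ t : ℝ, 1 ≤ t →
      HasDerivAt g (cstar * f t ^ ((p - 1) * m - 1) - k * φ (f t) / f t) t := fun t ht =>
    (hgode t (by linarith)).hasDerivAt (Ici_mem_nhds (by linarith))
  have hc := hφC1.continuousOn
  have hf : Tendsto f atTop (𝓝 1) := f_tendsto_aux δ φ f hc hφ1 hφpos hφneg
    (fun t ht => hfmem t (by linarith)) hf1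
  have hφ : Tendsto (fun t => φ (f t)) atTop (𝓝 0) := by
    have h := (hc.continuousAt (Icc_mem_nhds (by linarith) (by linarith) : _ ∈ 𝓝 (1 : ℝ))).tendsto
    rw [hφ1] at h
    exact h.comp hf
  have hlim : Tendsto (fun t => cstar * f t ^ ((p - 1) * m - 1) - k * φ (f t) / f t)
      atTop (𝓝 cstar) := by
    have h1 := ((hf.rpow_const (p := (p - 1) * m - 1) (Or.inl one_ne_zero)).const_mul cstar).sub
      ((hφ.const_mul k).div hf one_ne_zero)
    simpa using h1
  refine ⟨?_, ?_⟩
  · have hev := hlim.eventually_const_le (half_lt_self hcstar)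
    obtain ⟨T, hT⟩ := eventually_atTop.1 hev
    have hgr := growth_aux g _ (cstar / 2) (max 1 T)
      (fun t ht => hg1 t ((le_max_left _ _).trans ht))
      (fun t ht => hT t ((le_max_right _ _).trans ht))
    have hlin : Tendsto (fun t : ℝ => cstar / 2 * (t - max 1 T) + g (max 1 T)) atTop atTop := by
      apply tendsto_atTop_add_const_right
      apply Tendsto.const_mul_atTop (by linarith)
      exact tendsto_atTop_add_const_right _ _ tendsto_id
    refine tendsto_atTop_mono' _ ?_ hlin
    filter_upwards [eventually_ge_atTop (max 1 T)] with t ht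
    have := hgr _ t le_rfl ht
    linarith
  · refine hlim.congr' ?_
    filter_upwards [eventually_ge_atTop 1] with t ht
    exact (hg1 t ht).deriv.symm
end

section
/- Under the stated assumptions on the ODE system, there exists ξ₀ ∈ ℝ such that lim_{t→∞} (g(t) − c* t) = ξ₀. -/
open Set Filter Topology

lemma aux_anti (F F' : ℝ → ℝ) (h : ∀ t : ℝ, 0 ≤ t → HasDerivWithinAt F (F' t) (Ici 0) t)
    (hn : ∀ t : ℝ, 0 ≤ t → F' t ≤ 0) : AntitoneOn F (Ici 0) := by
  refine antitoneOn_of_hasDerivWithinAt_nonpos (f' := F') (convex_Ici 0)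
    (fun t ht => (h t ht).continuousWithinAt) (fun t ht => ?_) (fun t ht => ?_)
  · exact (h t (interior_subset ht)).mono interior_subset
  · exact hn t (interior_subset ht)

lemma aux_conv (G G' : ℝ → ℝ) (C l : ℝ) (hl : 0 < l) (hC : 0 ≤ C)
    (h : ∀ t : ℝ, 0 ≤ t → HasDerivWithinAt G (G' t) (Ici 0) t)
    (hb : ∀ t : ℝ, 0 ≤ t → |G' t| ≤ C * Real.exp (-l * t)) :
    ∃ x : ℝ, Tendsto G atTop (𝓝 x) := by
  have hE : ∀ t : ℝ, HasDerivAt (fun t => C / l * Real.exp (-l * t))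
      (-(C * Real.exp (-l * t))) t := by
    intro t
    have h1 : HasDerivAt (fun t : ℝ => -l * t) (-l) t := by
      simpa using (hasDerivAt_id t).const_mul (-l)
    have h2 := h1.exp.const_mul (C / l)
    have h3 : C / l * (Real.exp (-l * t) * -l) = -(C * Real.exp (-l * t)) := by
      rw [show C / l * (Real.exp (-l * t) * -l) = -(C / l * l * Real.exp (-l * t)) by ring,
        div_mul_cancel₀ _ hl.ne']
    rwa [h3] at h2
  have hP : AntitoneOn (fun t => G t + C / l * Real.exp (-l * t)) (Ici 0) := by
    refine aux_anti _ _ (fun t ht => (h t ht).add (hE t).hasDerivWithinAt) (fun t ht => ?_)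
    have := (abs_le.1 (hb t ht)).2
    linarith
  have hQ : AntitoneOn (fun t => -G t + C / l * Real.exp (-l * t)) (Ici 0) := by
    refine aux_anti _ _ (fun t ht => (h t ht).neg.add (hE t).hasDerivWithinAt) (fun t ht => ?_)
    have := (abs_le.1 (hb t ht)).1
    linarith
  have hEt : Tendsto (fun t => C / l * Real.exp (-l * t)) atTop (𝓝 0) := by
    have h1 : Tendsto (fun t : ℝ => -l * t) atTop atBot :=
      tendsto_id.const_mul_atTop_of_neg (by linarith)
    simpa using (Real.tendsto_exp_atBot.comp h1).const_mul (C / l)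
  have hPa : Antitone (fun t : ℝ => G (max t 0) + C / l * Real.exp (-l * (max t 0))) :=
    fun s t hst => hP (mem_Ici.2 (le_max_right _ _)) (mem_Ici.2 (le_max_right _ _))
      (max_le_max_right 0 hst)
  have hbdd : BddBelow (range (fun t : ℝ => G (max t 0) + C / l * Real.exp (-l * (max t 0)))) := by
    refine ⟨-(-G 0 + C / l * Real.exp (-l * 0)), ?_⟩
    rintro _ ⟨t, rfl⟩
    have h1 := hQ (mem_Ici.2 le_rfl) (mem_Ici.2 (le_max_right t 0)) (le_max_right t 0)
    have h2 : 0 ≤ C / l * Real.exp (-l * (max t 0)) := by positivity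
    simp only at h1 ⊢
    linarith
  have hlim := tendsto_atTop_ciInf hPa hbdd
  have heq : (fun t : ℝ => G (max t 0) + C / l * Real.exp (-l * (max t 0))) =ᶠ[atTop]
      (fun t => G t + C / l * Real.exp (-l * t)) := by
    filter_upwards [eventually_ge_atTop 0] with t ht
    rw [max_eq_left ht]
  exact ⟨_, ((hlim.congr' heq).sub hEt).congr fun t => by ring⟩

/-- Property (f) of solutions `(f,g)` of the ODE system
`f' = φ(f)`, `g' = c* f^{(p-1)m-1} - k φ(f)/f` on `[0,∞)`:
there exists `ξ₀ ∈ ℝ` such that `g(t) - c* t → ξ₀` as `t → ∞`. -/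
theorem statement16 (m p cstar k δ f₀ : ℝ) (φ f g : ℝ → ℝ)
    (hm : 0 < m) (hp : 1 < p) (hmp : 1 < m * (p - 1))
    (hcstar : 0 < cstar) (hk : 0 < k) (hδ0 : 0 < δ) (hδ1 : δ < 1)
    (hφC1 : ContDiffOn ℝ 1 φ (Icc (1 - δ) (1 + δ)))
    (hφ1 : φ 1 = 0)
    (hφ'1 : derivWithin φ (Icc (1 - δ) (1 + δ)) 1 < 0)
    (hφpos : ∀ u ∈ Ico (1 - δ) (1 : ℝ), 0 < φ u)
    (hφneg : ∀ u ∈ Ioc (1 : ℝ) (1 + δ), φ u < 0)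
    (hf0 : f 0 = f₀) (hf₀ : f₀ ∈ Ioo (1 - δ) (1 + δ))
    (hfmem : ∀ t : ℝ, 0 ≤ t → f t ∈ Icc (1 - δ) (1 + δ))
    (hfode : ∀ t : ℝ, 0 ≤ t → HasDerivWithinAt f (φ (f t)) (Ici 0) t)
    (hgode : ∀ t : ℝ, 0 ≤ t →
      HasDerivWithinAt g (cstar * f t ^ ((p - 1) * m - 1) - k * φ (f t) / f t)
        (Ici 0) t) :
    ∃ ξ₀ : ℝ, Tendsto (fun t => g t - cstar * t) atTop (nhds ξ₀) := by
  have hI : Icc (1 - δ) (1 + δ) ∈ 𝓝 (1 : ℝ) := Icc_mem_nhds (by linarith) (by linarith)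
  have h1I : (1 : ℝ) ∈ Icc (1 - δ) (1 + δ) := mem_of_mem_nhds hI
  have hφd : DifferentiableAt ℝ φ 1 :=
    ((hφC1.differentiableOn (by norm_num)) 1 h1I).differentiableAt hI
  rw [derivWithin_of_mem_nhds hI] at hφ'1
  have hDc := (continuousOn_dslope hI).2 ⟨hφC1.continuousOn, hφd⟩
  have hsl : ∀ (F : ℝ → ℝ), F 1 = 0 → ∀ u, F u = (u - 1) * dslope F 1 u := by
    intro F hF u
    have := sub_smul_dslope F 1 u
    rw [smul_eq_mul, hF, sub_zero] at this
    exact this.symm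
  -- negative upper bound for the slope
  obtain ⟨u0, hu0, hmax⟩ := isCompact_Icc.exists_isMaxOn ⟨1, h1I⟩ hDc
  have hneg : dslope φ 1 u0 < 0 := by
    rcases lt_trichotomy u0 1 with h | h | h
    · have h1 := hφpos u0 ⟨hu0.1, h⟩
      rw [hsl φ hφ1 u0] at h1
      by_contra hc
      nlinarith
    · rw [h, dslope_same]; exact hφ'1
    · have h1 := hφneg u0 ⟨h, hu0.2⟩
      rw [hsl φ hφ1 u0] at h1
      by_contra hc
      nlinarith
  obtain ⟨l, hl⟩ : ∃ l, l = -dslope φ 1 u0 := ⟨_, rfl⟩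
  have hlpos : 0 < l := by linarith
  have hDle : ∀ u ∈ Icc (1 - δ) (1 + δ), dslope φ 1 u ≤ -l := fun u hu => by
    have : dslope φ 1 u ≤ dslope φ 1 u0 := hmax hu
    linarith
  -- the remainder
  obtain ⟨H, hH⟩ : ∃ H : ℝ → ℝ, H = fun u =>
    cstar * u ^ ((p - 1) * m - 1) - k * φ u / u - cstar := ⟨_, rfl⟩
  have hH1 : H 1 = 0 := by simp [hH, hφ1]
  have hHc : ContinuousOn H (Icc (1 - δ) (1 + δ)) := by
    have hne : ∀ u ∈ Icc (1 - δ) (1 + δ), u ≠ 0 := fun u hu => by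
      have := hu.1
      intro h0
      linarith
    rw [hH]
    exact ((continuousOn_const.mul (continuousOn_id.rpow_const fun u hu => Or.inl (hne u hu))).sub
      ((continuousOn_const.mul hφC1.continuousOn).div continuousOn_id hne)).sub continuousOn_const
  have hHd : DifferentiableAt ℝ H 1 := by
    rw [hH]
    exact ((((differentiableAt_id (x := (1 : ℝ))).rpow_const (Or.inl one_ne_zero)).const_mul cstar).sub
      ((hφd.const_mul k).div differentiableAt_id one_ne_zero)).sub_const cstar
  obtain ⟨K, hK⟩ := isCompact_Icc.exists_bound_of_continuousOn
    ((continuousOn_dslope hI).2 ⟨hHc, hHd⟩)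
  have hK0 : 0 ≤ K := (norm_nonneg _).trans (hK 1 h1I)
  -- exponential decay
  have hEx : ∀ t : ℝ, HasDerivAt (fun t => Real.exp (l * t)) (Real.exp (l * t) * l) t := by
    intro t
    have h1 : HasDerivAt (fun t : ℝ => l * t) l t := by
      simpa using (hasDerivAt_id t).const_mul l
    exact h1.exp
  have hW : AntitoneOn (fun t => ((f t - 1) * Real.exp (l * t)) ^ 2) (Ici 0) := by
    refine aux_anti _ _ (fun t ht =>
      (((hfode t ht).sub_const 1).mul (hEx t).hasDerivWithinAt).pow 2) (fun t ht => ?_)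
    have h1 := hDle _ (hfmem t ht)
    rw [hsl φ hφ1 (f t)]
    have h2 : 0 ≤ ((f t - 1) * Real.exp (l * t)) ^ 2 := sq_nonneg _
    have h3 := mul_nonneg h2 (by linarith : 0 ≤ -l - dslope φ 1 (f t))
    simp only [Nat.cast_ofNat, Pi.mul_apply]
    norm_num
    nlinarith
  have hdec : ∀ t : ℝ, 0 ≤ t → |f t - 1| ≤ δ * Real.exp (-l * t) := by
    intro t ht
    have h1 := hW (mem_Ici.2 le_rfl) (mem_Ici.2 ht) ht
    simp only [mul_zero, Real.exp_zero, mul_one] at h1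
    have h2 := sq_le_sq.1 h1
    rw [abs_mul, Real.abs_exp] at h2
    have h0 := hfmem 0 le_rfl
    have h3 : |f 0 - 1| ≤ δ := abs_le.2 ⟨by linarith [h0.1], by linarith [h0.2]⟩
    rw [neg_mul, Real.exp_neg, ← div_eq_mul_inv, le_div_iff₀ (Real.exp_pos _)]
    linarith
  refine aux_conv _ (fun t => H (f t)) (K * δ) l hlpos (by positivity) (fun t ht => ?_)
    (fun t ht => ?_)
  · rw [hH]
    have h1 : HasDerivAt (fun t : ℝ => cstar * t) cstar t := by
      simpa using (hasDerivAt_id t).const_mul cstar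
    exact (hgode t ht).sub h1.hasDerivWithinAt
  · have h1 := hK _ (hfmem t ht)
    have h2 := hdec t ht
    show |H (f t)| ≤ _
    rw [hsl H hH1 (f t), abs_mul]
    rw [Real.norm_eq_abs] at h1
    calc _ ≤ (δ * Real.exp (-l * t)) * K := mul_le_mul h2 h1 (abs_nonneg _) (by positivity)
      _ = _ := by ring
end

section
/- Let Ω ⊆ ℝ^N be open, w ∈ C³(Ω), ζ ∈ C²(Ω), and let x₀ ∈ Ω be a local maximum of z := |∇w|² ζ² with ζ(x₀) > 0. Then, at the point x₀, ζ² Σ_{i,j,k=1}^N w_{x_i} w_{x_j} w_{x_k} w_{x_i x_j x_k} ≤ |∇w|² (2 ⟨∇ζ, ∇w⟩² − ζ ⟨(Hess ζ) ∇w, ∇w⟩). -/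
open Set Filter Topology RealInnerProductSpace

lemma second_test (g g1 : ℝ → ℝ) (g2 : ℝ) (h1 : ∀ᶠ t in 𝓝 (0:ℝ), HasDerivAt g (g1 t) t)
    (h2 : HasDerivAt g1 g2 0) (hm : IsLocalMax g 0) : g1 0 = 0 ∧ g2 ≤ 0 := by
  have h10 : g1 0 = 0 := hm.hasDerivAt_eq_zero h1.self_of_nhds
  refine ⟨h10, ?_⟩
  by_contra! hpos
  have hd : deriv g =ᶠ[𝓝 0] g1 := h1.mono fun t ht => ht.deriv
  have hdd : deriv (deriv g) 0 = g2 := by rw [hd.deriv_eq, h2.deriv]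
  have hmin := isLocalMin_of_deriv_deriv_pos (f := g) (x₀ := 0) (by rw [hdd]; exact hpos)
    (by rw [hd.self_of_nhds, h10]) h1.self_of_nhds.continuousAt
  have hc : g =ᶠ[𝓝 0] fun _ => g 0 := by
    filter_upwards [hm, hmin] with t a b using le_antisymm a b
  have : deriv (deriv g) 0 = 0 := by
    rw [hc.deriv.deriv_eq]; simp
  linarith

lemma oneD {E : Type*} [NormedAddCommGroup E] [InnerProductSpace ℝ E]
    (P P1 : ℝ → E) (P2 : E) (s s1 : ℝ → ℝ) (s2 : ℝ)
    (hP : ∀ᶠ t in 𝓝 (0:ℝ), HasDerivAt P (P1 t) t) (hP1 : HasDerivAt P1 P2 0)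
    (hs : ∀ᶠ t in 𝓝 (0:ℝ), HasDerivAt s (s1 t) t) (hs1 : HasDerivAt s1 s2 0)
    (hm : IsLocalMax (fun t => ‖P t‖ ^ 2 * s t ^ 2) 0) (h0 : 0 < s 0) :
    s 0 ^ 2 * ⟪P2, P 0⟫ ≤ ‖P 0‖ ^ 2 * (2 * s1 0 ^ 2 - s 0 * s2) := by
  have key := second_test _ (fun t => (2 * ⟪P t, P1 t⟫) * s t ^ 2 + ‖P t‖ ^ 2 * (2 * s t * s1 t))
    ((2 * (⟪P 0, P2⟫ + ⟪P1 0, P1 0⟫)) * s 0 ^ 2 + (2 * ⟪P 0, P1 0⟫) * (2 * s 0 * s1 0)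
      + ((2 * ⟪P 0, P1 0⟫) * (2 * s 0 * s1 0)
        + ‖P 0‖ ^ 2 * (2 * s1 0 * s1 0 + 2 * s 0 * s2)))
    (by
      filter_upwards [hP, hs] with t a b
      refine (a.norm_sq.mul (b.pow 2)).congr_deriv ?_
      simp) (by
      have a := hP.self_of_nhds
      have b := hs.self_of_nhds
      have A := ((a.inner ℝ hP1).const_mul 2).mul (b.pow 2)
      have B := a.norm_sq.mul ((b.const_mul 2).mul hs1)
      refine (A.add B).congr_deriv ?_
      simp) hm
  obtain ⟨k1, k2⟩ := key
  rw [real_inner_comm (P2) (P 0)] at *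
  by_cases hp : P 0 = 0
  · simp [hp]
  have hp2 : 0 < ‖P 0‖ ^ 2 := by positivity
  have cs := real_inner_mul_inner_self_le (P 0) (P1 0)
  rw [real_inner_self_eq_norm_sq (P 0)] at cs
  have k3 : ⟪P 0, P1 0⟫ * s 0 = - (‖P 0‖ ^ 2 * s1 0) := by
    have : 2 * s 0 * (⟪P 0, P1 0⟫ * s 0 + ‖P 0‖ ^ 2 * s1 0) = 0 := by linear_combination k1
    have := (mul_eq_zero.mp this).resolve_left (by positivity)
    linarith
  generalize ‖P 0‖ ^ 2 = n at *
  generalize ⟪P 0, P1 0⟫ = a at *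
  generalize ⟪P1 0, P1 0⟫ = b at *
  generalize ⟪P 0, P2⟫ = c at *
  generalize s 0 = σ at *
  generalize s1 0 = τ at *
  have k4 : n * τ ^ 2 ≤ b * σ ^ 2 := by
    have : n * (n * τ ^ 2) ≤ n * (b * σ ^ 2) := by
      have e : n * (n * τ ^ 2) = a * a * σ ^ 2 := by
        linear_combination (-(a * σ) + n * τ) * k3
      rw [e]; nlinarith [mul_le_mul_of_nonneg_right cs (sq_nonneg σ)]
    exact le_of_mul_le_mul_left this hp2
  have k5 : a * σ * τ = -(n * τ ^ 2) := by linear_combination τ * k3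
  nlinarith

lemma line_deriv {E F : Type*} [NormedAddCommGroup E] [NormedSpace ℝ E]
    [NormedAddCommGroup F] [NormedSpace ℝ F] (f : E → F) (x v : E) (t : ℝ)
    (h : DifferentiableAt ℝ f (x + t • v)) :
    HasDerivAt (fun t : ℝ => f (x + t • v)) (fderiv ℝ f (x + t • v) v) t := by
  have h2 : HasDerivAt (fun t : ℝ => x + t • v) v t := by
    simpa using ((hasDerivAt_id t).smul_const v).const_add x
  exact h.hasFDerivAt.comp_hasDerivAt t h2

lemma grad_inner {E : Type*} [NormedAddCommGroup E] [InnerProductSpace ℝ E] [CompleteSpace E]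
    (f : E → ℝ) (x v : E) : ⟪gradient f x, v⟫ = fderiv ℝ f x v := by
  simp [gradient]

lemma grad_cd {E : Type*} [NormedAddCommGroup E] [InnerProductSpace ℝ E] [CompleteSpace E]
    (f : E → ℝ) (x : E) (m n : WithTop ℕ∞) (hmn : m + 1 ≤ n) (h : ContDiffAt ℝ n f x) :
    ContDiffAt ℝ m (gradient f) x :=
  (InnerProductSpace.toDual ℝ E).symm.contDiff.contDiffAt.comp x (h.fderiv_right hmn)

lemma grad_fderiv {E : Type*} [NormedAddCommGroup E] [InnerProductSpace ℝ E] [CompleteSpace E]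
    (f : E → ℝ) (x v u : E) (h : ContDiffAt ℝ 2 f x) :
    ⟪fderiv ℝ (gradient f) x v, u⟫ = fderiv ℝ (fderiv ℝ f) x v u := by
  have h1 : DifferentiableAt ℝ (gradient f) x :=
    (grad_cd f x 1 2 (by norm_num) h).differentiableAt (by norm_num)
  have h2 : DifferentiableAt ℝ (fderiv ℝ f) x :=
    (h.fderiv_right (m := 1) (by norm_num)).differentiableAt (by norm_num)
  have e : (fun y => ⟪gradient f y, u⟫) = fun y => fderiv ℝ f y u :=
    funext fun y => grad_inner f y u
  have e2 := congrArg (fun q => fderiv ℝ q x v) e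
  rw [fderiv_inner_apply ℝ h1 (differentiableAt_const u),
    fderiv_clm_apply h2 (differentiableAt_const u)] at e2
  simpa using e2



/-- Second-order inequality at a local maximum of `z = |∇w|² ζ²`: at a local maximum
point `x₀` with `ζ(x₀) > 0`, the third derivative of `w` applied to `(∇w, ∇w, ∇w)`
satisfies `ζ² D³w(∇w,∇w,∇w) ≤ |∇w|² (2⟨∇ζ,∇w⟩² - ζ ⟨(Hess ζ)∇w, ∇w⟩)`. -/
theorem statement19 {N : ℕ} (hN : 1 ≤ N)
    (Ω : Set (EuclideanSpace ℝ (Fin N))) (hΩ : IsOpen Ω)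
    (w ζ : EuclideanSpace ℝ (Fin N) → ℝ)
    (hw : ContDiffOn ℝ 3 w Ω) (hζ : ContDiffOn ℝ 2 ζ Ω)
    (x₀ : EuclideanSpace ℝ (Fin N)) (hx₀ : x₀ ∈ Ω)
    (hmax : IsLocalMax (fun x => ‖gradient w x‖ ^ 2 * (ζ x) ^ 2) x₀)
    (hζ0 : 0 < ζ x₀) :
    ζ x₀ ^ 2 *
        iteratedFDeriv ℝ 3 w x₀ ![gradient w x₀, gradient w x₀, gradient w x₀]
      ≤ ‖gradient w x₀‖ ^ 2 *
        (2 * ⟪gradient ζ x₀, gradient w x₀⟫ ^ 2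
          - ζ x₀ * ⟪fderiv ℝ (gradient ζ) x₀ (gradient w x₀), gradient w x₀⟫) := by
  have hΩn := hΩ.mem_nhds hx₀
  have hwx : ContDiffAt ℝ 3 w x₀ := hw.contDiffAt hΩn
  have hζx : ContDiffAt ℝ 2 ζ x₀ := hζ.contDiffAt hΩn
  generalize hv : gradient w x₀ = v
  have hG : ContDiffAt ℝ 2 (gradient w) x₀ := grad_cd w x₀ 2 3 (by norm_num) hwx
  have hline : Tendsto (fun t : ℝ => x₀ + t • v) (𝓝 0) (𝓝 x₀) := by
    have : Continuous (fun t : ℝ => x₀ + t • v) := by fun_prop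
    simpa using this.tendsto 0
  have hwe : ∀ᶠ y in 𝓝 x₀, ContDiffAt ℝ 3 w y := hwx.eventually (by simp)
  have hζe : ∀ᶠ y in 𝓝 x₀, ContDiffAt ℝ 2 ζ y := hζx.eventually (by simp)
  have hGe : ∀ᶠ y in 𝓝 x₀, ContDiffAt ℝ 2 (gradient w) y := hG.eventually (by simp)
  have hG1 : DifferentiableAt ℝ (fderiv ℝ (gradient w)) x₀ :=
    (hG.fderiv_right (m := 1) (by norm_num)).differentiableAt (by norm_num)
  have hG1v : DifferentiableAt ℝ (fun y => fderiv ℝ (gradient w) y v) x₀ :=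
    hG1.clm_apply (differentiableAt_const v)
  have hζ1 : DifferentiableAt ℝ (fderiv ℝ ζ) x₀ :=
    (hζx.fderiv_right (m := 1) (by norm_num)).differentiableAt (by norm_num)
  have hζ1v : DifferentiableAt ℝ (fun y => fderiv ℝ ζ y v) x₀ :=
    hζ1.clm_apply (differentiableAt_const v)
  have main := oneD (fun t : ℝ => gradient w (x₀ + t • v))
    (fun t => fderiv ℝ (gradient w) (x₀ + t • v) v)
    (fderiv ℝ (fun y => fderiv ℝ (gradient w) y v) x₀ v)
    (fun t => ζ (x₀ + t • v)) (fun t => fderiv ℝ ζ (x₀ + t • v) v)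
    (fderiv ℝ (fun y => fderiv ℝ ζ y v) x₀ v)
    (by
      filter_upwards [hline.eventually hGe] with t ht
      exact line_deriv _ _ _ _ (ht.differentiableAt (by norm_num)))
    (by
      have := line_deriv (fun y => fderiv ℝ (gradient w) y v) x₀ v 0 (by simpa using hG1v)
      simpa using this)
    (by
      filter_upwards [hline.eventually hζe] with t ht
      exact line_deriv _ _ _ _ (ht.differentiableAt (by norm_num)))
    (by
      have := line_deriv (fun y => fderiv ℝ ζ y v) x₀ v 0 (by simpa using hζ1v)
      simpa using this)
    (by
      have := hline.eventually hmax
      simpa [IsLocalMax, IsMaxFilter] using this)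
    (by simpa using hζ0)
  simp only [zero_smul, add_zero, hv] at main
  have e3 : iteratedFDeriv ℝ 3 w x₀ ![v, v, v]
      = ⟪fderiv ℝ (fun y => fderiv ℝ (gradient w) y v) x₀ v, v⟫ := by
    have hI : DifferentiableAt ℝ (iteratedFDeriv ℝ 2 w) x₀ :=
      hwx.differentiableAt_iteratedFDeriv (by norm_num)
    have hE : (fun y => iteratedFDeriv ℝ 2 w y ![v, v])
        =ᶠ[𝓝 x₀] fun y => ⟪fderiv ℝ (gradient w) y v, v⟫ := by
      filter_upwards [hwe] with y hy
      rw [iteratedFDeriv_two_apply, grad_fderiv w y v v (hy.of_le (by norm_num))]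
      simp
    have h1 := DFunLike.congr_fun (hE.fderiv_eq (𝕜 := ℝ)) v
    rw [fderiv_inner_apply ℝ hG1v (differentiableAt_const v)] at h1
    rw [iteratedFDeriv_succ_apply_left]
    have h2 := fderiv_continuousMultilinear_apply_const_apply hI ![v, v] v
    rw [h2] at h1
    simpa [Fin.tail, Matrix.vecTail] using h1
  have e2 : ⟪fderiv ℝ (gradient ζ) x₀ v, v⟫ = fderiv ℝ (fun y => fderiv ℝ ζ y v) x₀ v := by
    rw [grad_fderiv ζ x₀ v v hζx, fderiv_clm_apply hζ1 (differentiableAt_const v)]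
    simp
  rw [e3, e2, grad_inner]
  exact main
end
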